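/- arXiv:1904.02076 — 6 statements merged into one kernel-verified Lean document; each statement's English description precedes it below -/
import Mathlib

section
/- An error configuration E is a good configuration if and only if the coordinates graph G_E is acyclic (contains no cycle). -/
open Filter Topology

/-- A configuration `E` of cells in the `(n+1) × (m+1)` grid is *good* if every nonempty
subset of `E` contains a cell that is the unique cell of the subset in its row,
or the unique cell of the subset in its column. -/
def IsGood (n m : ℕ) (E : Finset (Fin (n + 1) × Fin (m + 1))) : Prop :=
  ∀ E'' ⊆ E, E''.Nonempty →
    ∃ c ∈ E'', (∀ c' ∈ E'', c'.1 = c.1 → c' = c) ∨ (∀ c' ∈ E'', c'.2 = c.2 → c' = c)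

/-- The coordinates graph of a configuration: the bipartite graph on rows ⊕ columns where
row `i` is adjacent to column `j` iff `(i, j) ∈ E`. -/
def coordGraph (n m : ℕ) (E : Finset (Fin (n + 1) × Fin (m + 1))) :
    SimpleGraph (Fin (n + 1) ⊕ Fin (m + 1)) :=
  SimpleGraph.fromRel (fun u v => ∃ i j, u = Sum.inl i ∧ v = Sum.inr j ∧ (i, j) ∈ E)

/-- Total number of connected components of the coordinates graph (isolated vertices included). -/
noncomputable def Ncc (n m : ℕ) (E : Finset (Fin (n + 1) × Fin (m + 1))) : ℕ :=
  Nat.card (coordGraph n m E).ConnectedComponent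

/-- Number of connected components of the coordinates graph containing at least one edge. -/
noncomputable def Nnscc (n m : ℕ) (E : Finset (Fin (n + 1) × Fin (m + 1))) : ℕ :=
  Set.ncard {c : (coordGraph n m E).ConnectedComponent |
    ∃ u v, (coordGraph n m E).Adj u v ∧ (coordGraph n m E).connectedComponentMk u = c}

/-- Number of rows containing at least one cell of `E`. -/
def rowCount (n m : ℕ) (E : Finset (Fin (n + 1) × Fin (m + 1))) : ℕ :=
  (E.image Prod.fst).card

/-- Number of columns containing at least one cell of `E`. -/
def colCount (n m : ℕ) (E : Finset (Fin (n + 1) × Fin (m + 1))) : ℕ :=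
  (E.image Prod.snd).card

/-- `I(E)`: minimum cardinality of a feedback repair set of `E`, i.e. of a subset
`E' ⊆ E` such that `E \ E'` is a good configuration. -/
noncomputable def minFRS (n m : ℕ) (E : Finset (Fin (n + 1) × Fin (m + 1))) : ℕ :=
  sInf {k | ∃ E' ⊆ E, IsGood n m (E \ E') ∧ E'.card = k}

theorem cg_adj_lr {n m : ℕ} {E : Finset (Fin (n + 1) × Fin (m + 1))} {i j} :
    (coordGraph n m E).Adj (Sum.inl i) (Sum.inr j) ↔ (i, j) ∈ E := by
  simp [coordGraph]

theorem cg_adj {n m : ℕ} {E : Finset (Fin (n + 1) × Fin (m + 1))} {u v}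
    (h : (coordGraph n m E).Adj u v) :
    ∃ i j, (i, j) ∈ E ∧ ((u = Sum.inl i ∧ v = Sum.inr j) ∨ (u = Sum.inr j ∧ v = Sum.inl i)) := by
  rw [coordGraph, SimpleGraph.fromRel_adj] at h
  obtain ⟨-, ⟨i, j, h1, h2, h3⟩ | ⟨i, j, h1, h2, h3⟩⟩ := h
  · exact ⟨i, j, h3, Or.inl ⟨h1, h2⟩⟩
  · exact ⟨i, j, h3, Or.inr ⟨h2, h1⟩⟩

theorem acyclic_leaf {V : Type*} [Finite V] {H : SimpleGraph V} (hH : H.IsAcyclic)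
    {a b : V} (hab : H.Adj a b) : ∃ x y, H.Adj x y ∧ ∀ z, H.Adj x z → z = y := by
  haveI : Nonempty V := ⟨a⟩
  have ⟨u, v, p, hp, hmax⟩ := SimpleGraph.Walk.exists_isPath_forall_isPath_length_le_length H
  have hnil : ¬p.Nil := by
    intro hn
    have h1 := hmax a b (SimpleGraph.Path.singleton hab).1 (SimpleGraph.Path.singleton hab).2
    have h2 := SimpleGraph.Walk.nil_iff_length_eq.mp hn
    simp [SimpleGraph.Path.singleton] at h1
    omega
  refine ⟨u, _, p.adj_snd hnil, fun w hadj ↦ ?_⟩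
  apply hH.eq_snd_of_adj_start hp hadj
  by_contra hw
  have h3 := hmax _ _ _ (hp.cons hw (h := hadj.symm))
  simp at h3

theorem cycle_other {V : Type*} {G : SimpleGraph V} {u v w : V} {p : G.Walk u u}
    (hp : p.IsCycle) (h : s(v, w) ∈ p.edges) : ∃ z, z ≠ w ∧ s(v, z) ∈ p.edges := by
  have h2 := hp.ncard_neighborSet_toSubgraph_eq_two (p.fst_mem_support_of_mem_edges h)
  obtain ⟨z, hz, hne⟩ := Set.exists_ne_of_one_lt_ncard (h2 ▸ one_lt_two : 1 < (p.toSubgraph.neighborSet v).ncard) w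
  exact ⟨z, hne, SimpleGraph.Walk.adj_toSubgraph_iff_mem_edges.mp hz⟩

theorem good_iff_acyclic (n m : ℕ) (hn : 1 ≤ n) (hm : 1 ≤ m)
    (E : Finset (Fin (n + 1) × Fin (m + 1))) :
    IsGood n m E ↔ (coordGraph n m E).IsAcyclic := by
  constructor
  · intro hg u p hp
    classical
    set F := E.filter (fun c => s(Sum.inl c.1, Sum.inr c.2) ∈ p.edges) with hF
    have memF : ∀ i j, (i, j) ∈ F ↔ s(Sum.inl i, Sum.inr j) ∈ p.edges := by
      intro i j
      simp only [hF, Finset.mem_filter, and_iff_right_iff_imp]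
      exact fun h => cg_adj_lr.mp (p.adj_of_mem_edges h)
    have hne : F.Nonempty := by
      have hn : p.edges ≠ [] := by
        intro h0
        have h1 := hp.three_le_length
        rw [← p.length_edges, h0] at h1
        simp at h1
      obtain ⟨e, he⟩ := List.exists_mem_of_ne_nil _ hn
      induction e with | _ x y
      obtain ⟨i, j, -, ⟨rfl, rfl⟩ | ⟨rfl, rfl⟩⟩ := cg_adj (p.adj_of_mem_edges he)
      · exact ⟨(i, j), (memF i j).2 he⟩
      · exact ⟨(i, j), (memF i j).2 (Sym2.eq_swap ▸ he)⟩
    obtain ⟨⟨i, j⟩, hc, h | h⟩ := hg F (Finset.filter_subset _ _) hne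
    · obtain ⟨z, hz, hze⟩ := cycle_other hp ((memF i j).1 hc)
      obtain ⟨i', j', -, ⟨h1, rfl⟩ | ⟨h1, rfl⟩⟩ := cg_adj (p.adj_of_mem_edges hze)
      · have := h (i, j') ((memF i j').2 hze) rfl
        simp_all
      · simp at h1
    · obtain ⟨z, hz, hze⟩ := cycle_other hp (Sym2.eq_swap ▸ (memF i j).1 hc)
      obtain ⟨i', j', -, ⟨h1, rfl⟩ | ⟨h1, rfl⟩⟩ := cg_adj (p.adj_of_mem_edges hze)
      · simp at h1
      · have := h (i', j) ((memF i' j).2 (Sym2.eq_swap ▸ hze)) rfl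
        simp_all
  · rintro hG F hFE ⟨⟨a, b⟩, hab⟩
    have hle : coordGraph n m F ≤ coordGraph n m E := by
      intro u v h
      obtain ⟨i, j, hij, ⟨rfl, rfl⟩ | ⟨rfl, rfl⟩⟩ := cg_adj h
      · exact cg_adj_lr.2 (hFE hij)
      · exact (cg_adj_lr.2 (hFE hij)).symm
    obtain ⟨x, y, hxy, hu⟩ := acyclic_leaf (hG.anti hle) (cg_adj_lr.2 hab)
    obtain ⟨i, j, hij, ⟨rfl, rfl⟩ | ⟨rfl, rfl⟩⟩ := cg_adj hxy
    · refine ⟨(i, j), hij, Or.inl ?_⟩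
      rintro ⟨i', j'⟩ hc rfl
      have := hu _ (cg_adj_lr.2 hc)
      simp_all
    · refine ⟨(i, j), hij, Or.inr ?_⟩
      rintro ⟨i', j'⟩ hc rfl
      have := hu _ (cg_adj_lr.2 hc).symm
      simp_all
end

section
/- For error configurations E' ⊆ E, the set E' is a feedback repair set of E if and only if the coordinates graph G_{E∖E'} is acyclic; that is, the feedback repair sets of E are exactly the feedback edge sets of the graph G_E. -/
open Filter Topology

theorem adj_lr (n m : ℕ) (E : Finset (Fin (n + 1) × Fin (m + 1))) (i j) :
    (coordGraph n m E).Adj (Sum.inl i) (Sum.inr j) ↔ (i, j) ∈ E := by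
  simp [coordGraph]

theorem adj_rl (n m : ℕ) (E : Finset (Fin (n + 1) × Fin (m + 1))) (i j) :
    (coordGraph n m E).Adj (Sum.inr j) (Sum.inl i) ↔ (i, j) ∈ E := by
  simp [coordGraph]

theorem adj_ll (n m : ℕ) (E : Finset (Fin (n + 1) × Fin (m + 1))) (i j) :
    ¬ (coordGraph n m E).Adj (Sum.inl i) (Sum.inl j) := by
  simp [coordGraph]

theorem adj_rr (n m : ℕ) (E : Finset (Fin (n + 1) × Fin (m + 1))) (i j) :
    ¬ (coordGraph n m E).Adj (Sum.inr i) (Sum.inr j) := by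
  simp [coordGraph]

theorem long_path {V : Type*} [Fintype V] {G : SimpleGraph V} (hG : G.IsAcyclic)
    (h : ∀ u v, G.Adj u v → ∃ w, w ≠ u ∧ G.Adj v w) (a b : V) (hab : G.Adj a b) : False := by
  have key : ∀ k : ℕ, ∃ (v : V) (p : G.Walk a v), p.IsPath ∧ p.length = k + 1 := by
    intro k
    induction k with
    | zero => exact ⟨b, hab.toWalk, by simp [hab.ne], by simp⟩
    | succ k ih =>
      obtain ⟨v, p, hp, hl⟩ := ih
      have hn : ¬ p.Nil := by
        intro hn
        have := SimpleGraph.Walk.length_eq_zero_iff.mpr hn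
        omega
      obtain ⟨w, hw, hvw⟩ := h _ _ (p.adj_penultimate hn)
      refine ⟨w, p.concat hvw, hp.concat ?_ hvw, by simp [hl]⟩
      intro hws
      exact hw (hG.eq_penultimate_of_adj_end hp hvw hws)
  obtain ⟨v, p, hp, hl⟩ := key (Fintype.card V)
  have := hp.length_lt
  omega

theorem cyc_two {V : Type*} {G : SimpleGraph V} {u : V} (c : G.Walk u u) (hc : c.IsCycle)
    (v w : V) (h : s(v, w) ∈ c.edges) : ∃ x, x ≠ w ∧ s(v, x) ∈ c.edges := by
  have h2 := hc.ncard_neighborSet_toSubgraph_eq_two (c.fst_mem_support_of_mem_edges h)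
  obtain ⟨x, hx, hxw⟩ := Set.exists_ne_of_one_lt_ncard (h2 ▸ one_lt_two) w
  refine ⟨x, hxw, ?_⟩
  rwa [SimpleGraph.Subgraph.mem_neighborSet, SimpleGraph.Walk.adj_toSubgraph_iff_mem_edges] at hx

/-- For `E' ⊆ E`, the set `E'` is a feedback repair set of `E` (i.e. `E \ E'` is a good
configuration) if and only if the coordinates graph of `E \ E'` is acyclic; equivalently,
the feedback repair sets of `E` are exactly the feedback edge sets of `coordGraph E`. -/
theorem frs_iff_fes (n m : ℕ) (hn : 1 ≤ n) (hm : 1 ≤ m)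
    (E E' : Finset (Fin (n + 1) × Fin (m + 1))) (hE' : E' ⊆ E) :
    IsGood n m (E \ E') ↔ (coordGraph n m (E \ E')).IsAcyclic := by
  classical
  generalize E \ E' = F
  constructor
  · intro hg u c hc
    obtain ⟨d, hd, hd'⟩ := hg (F.filter fun x => s(Sum.inl x.1, Sum.inr x.2) ∈ c.edges)
      (Finset.filter_subset _ _) (by
        cases hcc : c with
        | nil => subst hcc; exact absurd rfl hc.ne_nil
        | @cons _ v _ h p =>
          rcases u with i | i <;> rcases v with j | j
          · exact absurd h (adj_ll _ _ _ _ _)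
          · exact ⟨(i, j), by simp [(adj_lr ..).1 h]⟩
          · exact ⟨(j, i), by simp [(adj_rl ..).1 h]⟩
          · exact absurd h (adj_rr _ _ _ _ _))
    obtain ⟨i, j⟩ := d
    simp only [Finset.mem_filter] at hd hd'
    rcases hd' with h | h
    · obtain ⟨x, hx, hxe⟩ := cyc_two c hc _ _ hd.2
      have ha := c.adj_of_mem_edges hxe
      rcases x with x | x
      · exact adj_ll _ _ _ _ _ ha
      · have := h (i, x) ⟨(adj_lr ..).1 ha, hxe⟩ rfl
        simp_all
    · have hd2 := hd.2
      rw [Sym2.eq_swap] at hd2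
      obtain ⟨x, hx, hxe⟩ := cyc_two c hc _ _ hd2
      have ha := c.adj_of_mem_edges hxe
      rcases x with x | x
      · have := h (x, j) ⟨(adj_rl ..).1 ha, by rwa [Sym2.eq_swap]⟩ rfl
        simp_all
      · exact adj_rr _ _ _ _ _ ha
  · intro hG D hD hne
    by_contra! hcon
    have hG' : (coordGraph n m D).IsAcyclic := by
      refine hG.anti ?_
      rintro (i | i) (j | j) h
      · exact absurd h (adj_ll _ _ _ _ _)
      · exact (adj_lr ..).2 (hD ((adj_lr ..).1 h))
      · exact (adj_rl ..).2 (hD ((adj_rl ..).1 h))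
      · exact absurd h (adj_rr _ _ _ _ _)
    obtain ⟨⟨a, b⟩, hab⟩ := hne
    refine long_path hG' ?_ _ _ ((adj_lr ..).2 hab)
    rintro (i | i) (j | j) h
    · exact absurd h (adj_ll _ _ _ _ _)
    · obtain ⟨-, ⟨x, y⟩, hx, hy, hxy⟩ := hcon _ ((adj_lr ..).1 h)
      simp only at hy
      subst hy
      exact ⟨Sum.inl x, by simpa using hxy, (adj_rl ..).2 hx⟩
    · obtain ⟨⟨⟨x, y⟩, hx, hy, hxy⟩, -⟩ := hcon _ ((adj_rl ..).1 h)
      simp only at hy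
      subst hy
      exact ⟨Sum.inr y, by simpa using hxy, (adj_lr ..).2 hx⟩
    · exact absurd h (adj_rr _ _ _ _ _)
end

section
/- For every error configuration E, the minimum cardinality of a feedback repair set of E equals |E| − R(E) − C(E) + N_nscc(E). -/
open Filter Topology

abbrev VV (n m : ℕ) := Fin (n + 1) ⊕ Fin (m + 1)

def xv (n m : ℕ) (e : Fin (n + 1) × Fin (m + 1)) : VV n m → ℚ :=
  Pi.single (Sum.inl e.1) 1 - Pi.single (Sum.inr e.2) 1

theorem adj_cases (n m : ℕ) (E : Finset (Fin (n + 1) × Fin (m + 1))) (u v : VV n m) :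
    (coordGraph n m E).Adj u v ↔
      ∃ i j, (i, j) ∈ E ∧ ((u = Sum.inl i ∧ v = Sum.inr j) ∨ (v = Sum.inl i ∧ u = Sum.inr j)) := by
  unfold coordGraph
  rw [SimpleGraph.fromRel_adj]
  constructor
  · rintro ⟨_, ⟨i, j, h1, h2, h3⟩ | ⟨i, j, h1, h2, h3⟩⟩
    · exact ⟨i, j, h3, Or.inl ⟨h1, h2⟩⟩
    · exact ⟨i, j, h3, Or.inr ⟨h1, h2⟩⟩
  · rintro ⟨i, j, h3, ⟨rfl, rfl⟩ | ⟨rfl, rfl⟩⟩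
    · exact ⟨by simp, Or.inl ⟨i, j, rfl, rfl, h3⟩⟩
    · exact ⟨by simp, Or.inr ⟨i, j, rfl, rfl, h3⟩⟩

theorem rank_Ncc (n m : ℕ) (E : Finset (Fin (n + 1) × Fin (m + 1))) :
    Module.finrank ℚ (Submodule.span ℚ (xv n m '' (E : Set _))) + Ncc n m E
      = Fintype.card (VV n m) := by
  classical
  let A : Matrix E (VV n m) ℚ := Matrix.of (fun e => xv n m e)
  have hmul : ∀ f e, A.mulVecLin f e = f (Sum.inl e.1.1) - f (Sum.inr e.1.2) := by
    intro f e
    change xv n m e ⬝ᵥ f = _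
    rw [xv, sub_dotProduct, single_dotProduct, single_dotProduct, one_mul, one_mul]
  have h1 : A.rank = Module.finrank ℚ (Submodule.span ℚ (xv n m '' (E : Set _))) := by
    rw [Matrix.rank_eq_finrank_span_row]
    have : Set.range A.row = xv n m '' (E : Set _) := by
      rw [Set.image_eq_range]
      rfl
    rw [this]
  have hr := LinearMap.finrank_range_add_finrank_ker A.mulVecLin
  have hker : LinearMap.ker A.mulVecLin =
      LinearMap.range (LinearMap.funLeft ℚ ℚ (coordGraph n m E).connectedComponentMk) := by
    ext f
    rw [LinearMap.mem_ker, LinearMap.mem_range]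
    constructor
    · intro h
      have hadj : ∀ u v, (coordGraph n m E).Adj u v → f u = f v := by
        intro u v huv
        obtain ⟨i, j, hE, h'⟩ := (adj_cases n m E u v).1 huv
        have := congrFun h ⟨(i, j), hE⟩
        rw [hmul] at this
        simp only [Pi.zero_apply] at this
        rcases h' with ⟨rfl, rfl⟩ | ⟨rfl, rfl⟩ <;> linarith
      have hw : ∀ u v, (coordGraph n m E).Walk u v → f u = f v := by
        intro u v p
        induction p with
        | nil => rfl
        | cons h p ih => exact (hadj _ _ h).trans ih
      refine ⟨fun c => SimpleGraph.ConnectedComponent.lift f (fun u v p _ => hw u v p) c, ?_⟩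
      ext v
      simp [LinearMap.funLeft]
    · rintro ⟨g, rfl⟩
      ext e
      rw [hmul]
      have : (coordGraph n m E).connectedComponentMk (Sum.inl e.1.1) =
        (coordGraph n m E).connectedComponentMk (Sum.inr e.1.2) := by
        apply SimpleGraph.ConnectedComponent.sound
        apply SimpleGraph.Adj.reachable
        rw [adj_cases]
        exact ⟨e.1.1, e.1.2, e.2, Or.inl ⟨rfl, rfl⟩⟩
      simp [LinearMap.funLeft_apply, this]
  have hk : Module.finrank ℚ (LinearMap.ker A.mulVecLin) = Ncc n m E := by
    rw [hker, LinearMap.finrank_range_of_inj]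
    · rw [Module.finrank_fintype_fun_eq_card, Ncc, Nat.card_eq_fintype_card]
    · apply LinearMap.funLeft_injective_of_surjective
      exact SimpleGraph.ConnectedComponent.ind (fun v => ⟨v, rfl⟩)
  rw [Module.finrank_fintype_fun_eq_card, hk] at hr
  rw [← h1, Matrix.rank]
  exact hr

theorem count_iso (n m : ℕ) (E : Finset (Fin (n + 1) × Fin (m + 1))) :
    Fintype.card (VV n m) + Nnscc n m E = rowCount n m E + colCount n m E + Ncc n m E := by
  classical
  set S : Set (VV n m) := {u | ∃ v, (coordGraph n m E).Adj u v} with hS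
  have h1 : S.ncard = rowCount n m E + colCount n m E := by
    have : S = ((E.image Prod.fst).disjSum (E.image Prod.snd) : Finset (VV n m)) := by
      ext u
      simp only [hS, Set.mem_ofPred_eq, adj_cases, Finset.mem_coe]
      rcases u with i | j <;> simp
    rw [this, Set.ncard_coe_finset, Finset.card_disjSum]; rfl
  set T : Set (coordGraph n m E).ConnectedComponent := {c |
    ∃ u v, (coordGraph n m E).Adj u v ∧ (coordGraph n m E).connectedComponentMk u = c} with hT
  have h2 : T.ncard = Nnscc n m E := rfl
  have h3 : Sᶜ.ncard = Tᶜ.ncard := by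
    have hiso : ∀ u ∉ S, ∀ v, (coordGraph n m E).Reachable u v → u = v := by
      rintro u hu v ⟨p⟩
      cases p with
      | nil => rfl
      | cons h p => exact absurd ⟨_, h⟩ hu
    apply Set.ncard_congr (fun v _ => (coordGraph n m E).connectedComponentMk v)
    · rintro u hu ⟨a, b, hab, h⟩
      have := hiso u hu a (SimpleGraph.ConnectedComponent.exact h).symm
      subst this
      exact hu ⟨b, hab⟩
    · intro u v hu hv h
      exact hiso u hu v (SimpleGraph.ConnectedComponent.exact h)
    · intro c
      induction c using SimpleGraph.ConnectedComponent.ind with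
      | _ v =>
      intro hc
      exact ⟨v, fun ⟨w, hw⟩ => hc ⟨v, w, hw, rfl⟩, rfl⟩
  have h4 := Set.ncard_add_ncard_compl S
  have h5 := Set.ncard_add_ncard_compl T
  rw [Nat.card_eq_fintype_card] at h4
  change _ = Ncc n m E at h5
  omega

theorem rank_eq (n m : ℕ) (E : Finset (Fin (n + 1) × Fin (m + 1))) :
    Module.finrank ℚ (Submodule.span ℚ (xv n m '' (E : Set _))) + Nnscc n m E
      = rowCount n m E + colCount n m E := by
  have := rank_Ncc n m E
  have := count_iso n m E
  omega

theorem card_indep (n m : ℕ) (E : Finset (Fin (n + 1) × Fin (m + 1)))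
    (h : LinearIndepOn ℚ (xv n m) (E : Set (Fin (n + 1) × Fin (m + 1)))) :
    Module.finrank ℚ (Submodule.span ℚ (xv n m '' (E : Set _))) = E.card := by
  have h' : LinearIndependent ℚ (fun e : E => xv n m e) := h
  have := finrank_span_eq_card h'
  rw [Fintype.card_coe] at this
  rw [← this, Set.image_eq_range]
  rfl

theorem good_indep (n m : ℕ) (E : Finset (Fin (n + 1) × Fin (m + 1))) (h : IsGood n m E) :
    LinearIndepOn ℚ (xv n m) (E : Set (Fin (n + 1) × Fin (m + 1))) := by
  classical
  rw [linearIndepOn_finset_iff]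
  intro f hf
  by_contra hne
  push Not at hne
  obtain ⟨e, he, hfe⟩ := hne
  obtain ⟨c, hc, hu⟩ := h (E.filter (fun e => f e ≠ 0)) (Finset.filter_subset _ _)
    ⟨e, Finset.mem_filter.2 ⟨he, hfe⟩⟩
  rw [Finset.mem_filter] at hc
  apply hc.2
  rcases hu with hu | hu
  · have := congrFun hf (Sum.inl c.1)
    rw [Finset.sum_apply, Finset.sum_eq_single c] at this
    · simpa [xv] using this
    · intro b hb hbc
      by_cases hb0 : f b = 0
      · simp [hb0]
      · have : c.1 ≠ b.1 := fun hh => hbc (hu b (Finset.mem_filter.2 ⟨hb, hb0⟩) hh.symm)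
        simp [xv, Pi.single_apply, this]
    · exact fun hh => absurd hc.1 hh
  · have := congrFun hf (Sum.inr c.2)
    rw [Finset.sum_apply, Finset.sum_eq_single c] at this
    · simpa [xv] using this
    · intro b hb hbc
      by_cases hb0 : f b = 0
      · simp [hb0]
      · have : c.2 ≠ b.2 := fun hh => hbc (hu b (Finset.mem_filter.2 ⟨hb, hb0⟩) hh.symm)
        simp [xv, Pi.single_apply, this]
    · exact fun hh => absurd hc.1 hh

theorem two_mul_image {α β : Type*} [DecidableEq α] [DecidableEq β] (s : Finset α) (g : α → β)
    (h : ∀ c ∈ s, ∃ c' ∈ s, g c' = g c ∧ c' ≠ c) : 2 * (s.image g).card ≤ s.card := by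
  apply Finset.mul_card_image_le_card
  intro b hb
  obtain ⟨c, hc, rfl⟩ := Finset.mem_image.1 hb
  obtain ⟨c', hc', h1, h2⟩ := h c hc
  exact Finset.one_lt_card.2 ⟨c', by simp [hc', h1], c, by simp [hc], h2⟩

theorem indep_good (n m : ℕ) (E : Finset (Fin (n + 1) × Fin (m + 1)))
    (h : LinearIndepOn ℚ (xv n m) (E : Set (Fin (n + 1) × Fin (m + 1)))) : IsGood n m E := by
  classical
  intro F hF hne
  by_contra hcon
  push Not at hcon
  have hc := card_indep n m F (h.mono (by exact_mod_cast hF))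
  have hr := rank_eq n m F
  have h1 : 2 * rowCount n m F ≤ F.card := two_mul_image F _ (fun c hc => (hcon c hc).1)
  have h2 : 2 * colCount n m F ≤ F.card := two_mul_image F _ (fun c hc => (hcon c hc).2)
  have h3 : 0 < Nnscc n m F := by
    rw [Nnscc, Set.ncard_pos]
    obtain ⟨⟨i, j⟩, hij⟩ := hne
    exact ⟨_, Sum.inl i, Sum.inr j, (adj_cases _ _ _ _ _).2 ⟨i, j, hij, Or.inl ⟨rfl, rfl⟩⟩, rfl⟩
  omega

/-- The minimum cardinality of a feedback repair set of `E` equals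
`|E| − R(E) − C(E) + N_nscc(E)`. -/
theorem minFRS_eq (n m : ℕ) (hn : 1 ≤ n) (hm : 1 ≤ m)
    (E : Finset (Fin (n + 1) × Fin (m + 1))) :
    (minFRS n m E : ℤ) =
      (E.card : ℤ) - rowCount n m E - colCount n m E + Nnscc n m E := by
  classical
  have hr := rank_eq n m E
  set r := Module.finrank ℚ (Submodule.span ℚ (xv n m '' (E : Set _))) with hrdef
  have hmain : IsLeast {k | ∃ E' ⊆ E, IsGood n m (E \ E') ∧ E'.card = k} (E.card - r)
      ∧ r ≤ E.card := by
    have hex : ∃ F ⊆ E, LinearIndepOn ℚ (xv n m) (F : Set (Fin (n + 1) × Fin (m + 1)))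
        ∧ F.card = r := by
      obtain ⟨u, huE, -, hsp, hli⟩ := exists_linearIndepOn_extension
        (linearIndepOn_empty ℚ (xv n m)) (Set.empty_subset (E : Set (Fin (n + 1) × Fin (m + 1))))
      lift u to Finset (Fin (n + 1) × Fin (m + 1)) using Set.toFinite u
      refine ⟨u, by exact_mod_cast huE, hli, ?_⟩
      rw [← card_indep n m u hli, hrdef]
      rw [le_antisymm (Submodule.span_mono (Set.image_mono huE)) (Submodule.span_le.2 hsp)]
    obtain ⟨F, hFE, hli, hcard⟩ := hex
    have hle : r ≤ E.card := hcard ▸ Finset.card_le_card hFE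
    refine ⟨⟨⟨E \ F, Finset.sdiff_subset, ?_, ?_⟩, ?_⟩, hle⟩
    · rw [Finset.sdiff_sdiff_eq_self hFE]
      exact indep_good n m F hli
    · rw [Finset.card_sdiff_of_subset hFE, hcard]
    · rintro k ⟨E', hE', hg, rfl⟩
      have h1 := card_indep n m _ (good_indep n m _ hg)
      have h2 : Module.finrank ℚ (Submodule.span ℚ (xv n m '' ((E \ E' : Finset _) : Set _))) ≤ r :=
        Submodule.finrank_mono (Submodule.span_mono (Set.image_mono
          (by exact_mod_cast Finset.sdiff_subset)))
      have h3 := Finset.card_sdiff_of_subset hE'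
      have h4 := Finset.card_le_card hE'
      omega
  obtain ⟨h1, h2⟩ := hmain
  have : minFRS n m E = E.card - r := h1.csInf_eq
  omega
end

section
/- For every error configuration E, the minimum cardinality I(E) of a feedback repair set of E equals |E| + N_cc(E) − (n + m + 2). -/
open Filter Topology

section CompLemmas
variable {V : Type} {G G' : SimpleGraph V}

lemma cc_lt [Finite V] (h : G ≤ G') {u v : V} (hu : ¬ G.Reachable u v) (hv : G'.Reachable u v) :
    Nat.card G'.ConnectedComponent + 1 ≤ Nat.card G.ConnectedComponent := by
  classical
  have := Fintype.ofFinite G.ConnectedComponent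
  have := Fintype.ofFinite G'.ConnectedComponent
  rw [Nat.card_eq_fintype_card, Nat.card_eq_fintype_card]
  refine Fintype.card_lt_of_surjective_not_injective _
    (SimpleGraph.ConnectedComponent.surjective_map_ofLE h) ?_
  intro hi
  apply hu
  have := @hi (G.connectedComponentMk u) (G.connectedComponentMk v)
    (by simpa using hv)
  simpa using this

lemma cc_mono [Finite V] (h : G ≤ G') :
    Nat.card G'.ConnectedComponent ≤ Nat.card G.ConnectedComponent :=
  Nat.card_le_card_of_surjective _ <| SimpleGraph.ConnectedComponent.surjective_map_ofLE h

lemma reach_cases {u v : V}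
    (hA : ∀ x y, G'.Adj x y → G.Adj x y ∨ (x = u ∧ y = v) ∨ (x = v ∧ y = u))
    {x y : V} (hr : G'.Reachable x y) :
    G.Reachable x y ∨ (G.Reachable x u ∧ G.Reachable v y) ∨
      (G.Reachable x v ∧ G.Reachable u y) := by
  obtain ⟨p⟩ := hr
  induction p with
  | nil => exact Or.inl (SimpleGraph.Reachable.refl _)
  | cons hadj p ih =>
    rcases hA _ _ hadj with h | ⟨rfl, rfl⟩ | ⟨rfl, rfl⟩
    · rcases ih with h1 | ⟨h1, h2⟩ | ⟨h1, h2⟩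
      · exact Or.inl (h.reachable.trans h1)
      · exact Or.inr (Or.inl ⟨h.reachable.trans h1, h2⟩)
      · exact Or.inr (Or.inr ⟨h.reachable.trans h1, h2⟩)
    · rcases ih with h1 | ⟨h1, h2⟩ | ⟨h1, h2⟩
      · exact Or.inr (Or.inl ⟨.refl _, h1⟩)
      · exact Or.inr (Or.inl ⟨.refl _, h2⟩)
      · exact Or.inl h2
    · rcases ih with h1 | ⟨h1, h2⟩ | ⟨h1, h2⟩
      · exact Or.inr (Or.inr ⟨.refl _, h1⟩)
      · exact Or.inl h2
      · exact Or.inr (Or.inr ⟨.refl _, h2⟩)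

lemma cc_eq [Finite V] (h : G ≤ G') {u v : V}
    (hA : ∀ x y, G'.Adj x y → G.Adj x y ∨ (x = u ∧ y = v) ∨ (x = v ∧ y = u))
    (hu : G.Reachable u v) :
    Nat.card G'.ConnectedComponent = Nat.card G.ConnectedComponent := by
  refine le_antisymm (cc_mono h) ?_
  refine Nat.card_le_card_of_injective (SimpleGraph.ConnectedComponent.map
    (SimpleGraph.Hom.ofLE h)) ?_
  intro a b
  induction a using SimpleGraph.ConnectedComponent.ind with | _ a
  induction b using SimpleGraph.ConnectedComponent.ind with | _ b
  intro hab
  have hr : G'.Reachable a b := by simpa using hab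
  rw [SimpleGraph.ConnectedComponent.eq]
  rcases reach_cases hA hr with h1 | ⟨h1, h2⟩ | ⟨h1, h2⟩
  · exact h1
  · exact h1.trans (hu.trans h2)
  · exact h1.trans (hu.symm.trans h2)

lemma cc_le_succ [Finite V] (h : G ≤ G') {u v : V}
    (hA : ∀ x y, G'.Adj x y → G.Adj x y ∨ (x = u ∧ y = v) ∨ (x = v ∧ y = u)) :
    Nat.card G.ConnectedComponent ≤ Nat.card G'.ConnectedComponent + 1 := by
  classical
  rw [← Finite.card_option]
  refine Nat.card_le_card_of_injective (fun C => if C = G.connectedComponentMk v then none else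
    some (SimpleGraph.ConnectedComponent.map (SimpleGraph.Hom.ofLE h) C)) ?_
  intro a b
  induction a using SimpleGraph.ConnectedComponent.ind with | _ a
  induction b using SimpleGraph.ConnectedComponent.ind with | _ b
  intro hab
  dsimp only at hab
  split_ifs at hab with h1 h2 h2
  · rw [h1, h2]
  · have hr : G'.Reachable a b := by simpa using hab
    rw [SimpleGraph.ConnectedComponent.eq] at h1 h2 ⊢
    rcases reach_cases hA hr with h3 | ⟨h3, h4⟩ | ⟨h3, h4⟩
    · exact h3
    · exact absurd h4.symm h2
    · exact absurd h3 h1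
end CompLemmas

section Coord
variable {n m : ℕ}

lemma coord_adj {E : Finset (Fin (n + 1) × Fin (m + 1))} (x y) :
    (coordGraph n m E).Adj x y ↔ (∃ i j, x = Sum.inl i ∧ y = Sum.inr j ∧ (i, j) ∈ E) ∨
      (∃ i j, y = Sum.inl i ∧ x = Sum.inr j ∧ (i, j) ∈ E) := by
  unfold coordGraph
  rw [SimpleGraph.fromRel_adj]
  constructor
  · exact fun h => h.2
  · refine fun h => ⟨?_, h⟩
    rcases h with ⟨i, j, rfl, rfl, _⟩ | ⟨i, j, rfl, rfl, _⟩ <;> simp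

lemma coord_mono {E F : Finset (Fin (n + 1) × Fin (m + 1))} (h : F ⊆ E) :
    coordGraph n m F ≤ coordGraph n m E := by
  intro x y
  rw [coord_adj, coord_adj]
  rintro (⟨i, j, hx, hy, he⟩ | ⟨i, j, hx, hy, he⟩)
  · exact Or.inl ⟨i, j, hx, hy, h he⟩
  · exact Or.inr ⟨i, j, hx, hy, h he⟩

lemma coord_insert (E : Finset (Fin (n + 1) × Fin (m + 1))) (e : Fin (n + 1) × Fin (m + 1)) (x y) :
    (coordGraph n m (insert e E)).Adj x y → (coordGraph n m E).Adj x y ∨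
      (x = Sum.inl e.1 ∧ y = Sum.inr e.2) ∨ (x = Sum.inr e.2 ∧ y = Sum.inl e.1) := by
  rw [coord_adj, coord_adj]
  rintro (⟨i, j, hx, hy, he⟩ | ⟨i, j, hx, hy, he⟩)
  · rcases Finset.mem_insert.1 he with rfl | he
    · exact Or.inr (Or.inl ⟨hx, hy⟩)
    · exact Or.inl (Or.inl ⟨i, j, hx, hy, he⟩)
  · rcases Finset.mem_insert.1 he with rfl | he
    · exact Or.inr (Or.inr ⟨hy, hx⟩)
    · exact Or.inl (Or.inr ⟨i, j, hx, hy, he⟩)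

lemma coord_reach {E : Finset (Fin (n + 1) × Fin (m + 1))} {e} (h : e ∈ E) :
    (coordGraph n m E).Reachable (Sum.inl e.1) (Sum.inr e.2) :=
  SimpleGraph.Adj.reachable ((coord_adj _ _).2 (Or.inl ⟨e.1, e.2, rfl, rfl, h⟩))

lemma isolated_reach {V : Type} {G : SimpleGraph V} {x y : V} (h : ∀ z, ¬ G.Adj x z)
    (hr : G.Reachable x y) : x = y := by
  obtain ⟨p⟩ := hr
  cases p with
  | nil => rfl
  | cons ha _ => exact absurd ha (h _)

lemma good_card (F : Finset (Fin (n + 1) × Fin (m + 1))) (hF : IsGood n m F) :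
    F.card + Ncc n m F ≤ n + m + 2 := by
  classical
  induction hk : F.card generalizing F with
  | zero =>
    have : Ncc n m F ≤ Nat.card (Fin (n + 1) ⊕ Fin (m + 1)) :=
      Nat.card_le_card_of_surjective (coordGraph n m F).connectedComponentMk
        (fun C => C.exists_rep)
    simp at this
    omega
  | succ k ih =>
    obtain ⟨c, hc, hu⟩ := hF F subset_rfl (Finset.card_pos.1 (by omega))
    have hc1 : (F.erase c).card = k := by rw [Finset.card_erase_of_mem hc]; omega
    have h1 := ih (F.erase c) (fun S hS => hF S (hS.trans (Finset.erase_subset _ _))) hc1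
    have h2 : Ncc n m F + 1 ≤ Ncc n m (F.erase c) := by
      refine cc_lt (coord_mono (Finset.erase_subset _ _)) (u := Sum.inl c.1) (v := Sum.inr c.2)
        ?_ (coord_reach hc)
      rcases hu with hu | hu
      · intro hr
        have := isolated_reach (x := Sum.inl c.1) ?_ hr
        · simp at this
        intro z
        rw [coord_adj]
        rintro (⟨i, j, hx, hy, he⟩ | ⟨i, j, hx, hy, he⟩)
        · have := hu _ (Finset.mem_of_mem_erase he) (by simpa using hx.symm)
          exact Finset.ne_of_mem_erase he this
        · simp at hy
      · intro hr
        have := isolated_reach (x := Sum.inr c.2) ?_ hr.symm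
        · simp at this
        intro z
        rw [coord_adj]
        rintro (⟨i, j, hx, hy, he⟩ | ⟨i, j, hx, hy, he⟩)
        · simp at hx
        · have := hu _ (Finset.mem_of_mem_erase he) (by simpa using hy.symm)
          exact Finset.ne_of_mem_erase he this
    omega

lemma card_ncc_mono (S F : Finset (Fin (n + 1) × Fin (m + 1))) (h : S ⊆ F) :
    S.card + Ncc n m S ≤ F.card + Ncc n m F := by
  classical
  have key : ∀ T : Finset (Fin (n + 1) × Fin (m + 1)),
      S.card + Ncc n m S ≤ (S ∪ T).card + Ncc n m (S ∪ T) := by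
    intro T
    induction T using Finset.induction_on with
    | empty => simp
    | insert e T _ ih =>
      rw [Finset.union_insert]
      by_cases he : e ∈ S ∪ T
      · rwa [Finset.insert_eq_of_mem he]
      · have : Ncc n m (S ∪ T) ≤ Ncc n m (insert e (S ∪ T)) + 1 :=
          cc_le_succ (coord_mono (Finset.subset_insert _ _)) (coord_insert (S ∪ T) e)
        rw [Finset.card_insert_of_notMem he]
        omega
  have := key F
  rwa [Finset.union_eq_right.2 h] at this

lemma isolated_count (S : Finset (Fin (n + 1) × Fin (m + 1))) (hne : S.Nonempty) :
    (n + m + 2) + 1 ≤ Ncc n m S + (S.image Prod.fst).card + (S.image Prod.snd).card := by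
  classical
  obtain ⟨c, hc⟩ := hne
  let A := (S.image Prod.fst)ᶜ
  let B := (S.image Prod.snd)ᶜ
  have hA : A.card + (S.image Prod.fst).card = n + 1 := by
    exact (Finset.card_compl_add_card (S.image Prod.fst)).trans (Fintype.card_fin _)
  have hB : B.card + (S.image Prod.snd).card = m + 1 := by
    exact (Finset.card_compl_add_card (S.image Prod.snd)).trans (Fintype.card_fin _)
  have hAi : ∀ a ∈ A, ∀ z, ¬ (coordGraph n m S).Adj (Sum.inl a) z := by
    intro a ha z
    rw [coord_adj]
    rintro (⟨i, j, hx, hy, he⟩ | ⟨i, j, hx, hy, he⟩)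
    · obtain rfl : a = i := by simpa using hx
      exact Finset.mem_compl.1 ha (Finset.mem_image.2 ⟨_, he, rfl⟩)
    · simp at hy
  have hBi : ∀ a ∈ B, ∀ z, ¬ (coordGraph n m S).Adj (Sum.inr a) z := by
    intro a ha z
    rw [coord_adj]
    rintro (⟨i, j, hx, hy, he⟩ | ⟨i, j, hx, hy, he⟩)
    · simp at hx
    · obtain rfl : a = j := by simpa using hy
      exact Finset.mem_compl.1 ha (Finset.mem_image.2 ⟨_, he, rfl⟩)
  let T := A.disjSum B
  have hT : ∀ t ∈ T, ∀ z, ¬ (coordGraph n m S).Adj t z := by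
    intro t ht
    rcases Finset.mem_disjSum.1 ht with ⟨a, ha, rfl⟩ | ⟨a, ha, rfl⟩
    · exact hAi a ha
    · exact hBi a ha
  have hcT : Sum.inl c.1 ∉ T := by
    intro h
    refine hT _ h (Sum.inr c.2) ((coord_adj _ _).2 (Or.inl ⟨c.1, c.2, rfl, rfl, hc⟩))
  have hcard : (insert (Sum.inl c.1) T).card ≤ Ncc n m S := by
    have hinj : Set.InjOn (coordGraph n m S).connectedComponentMk
        (insert (Sum.inl c.1) T : Finset _) := by
      intro a ha b hb hab
      have hr : (coordGraph n m S).Reachable a b := SimpleGraph.ConnectedComponent.exact hab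
      rcases Finset.mem_insert.1 ha with ha | ha
      · rcases Finset.mem_insert.1 hb with hb | hb
        · rw [ha, hb]
        · exact (isolated_reach (hT b hb) hr.symm).symm
      · exact isolated_reach (hT a ha) hr
    have := Fintype.ofFinite (coordGraph n m S).ConnectedComponent
    rw [← Finset.card_image_of_injOn hinj, Ncc, Nat.card_eq_fintype_card]
    exact Finset.card_le_univ _
  rw [Finset.card_insert_of_notMem hcT, Finset.card_disjSum] at hcard
  omega

lemma good_of_card (F : Finset (Fin (n + 1) × Fin (m + 1)))
    (hF : F.card + Ncc n m F ≤ n + m + 2) : IsGood n m F := by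
  classical
  intro S hS hne
  by_contra hcon
  push Not at hcon
  have h1 := card_ncc_mono S F hS
  have hr : 2 * (S.image Prod.fst).card ≤ S.card := by
    refine Finset.mul_card_image_le_card S 2 ?_
    intro b hb
    obtain ⟨c, hc, rfl⟩ := Finset.mem_image.1 hb
    obtain ⟨c', hc', h, h'⟩ := (hcon c hc).1
    exact Finset.one_lt_card.2 ⟨c, by simp [hc], c', by simp [hc', h], h'.symm⟩
  have hc : 2 * (S.image Prod.snd).card ≤ S.card := by
    refine Finset.mul_card_image_le_card S 2 ?_
    intro b hb
    obtain ⟨c, hc, rfl⟩ := Finset.mem_image.1 hb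
    obtain ⟨c', hc', h, h'⟩ := (hcon c hc).2
    exact Finset.one_lt_card.2 ⟨c, by simp [hc], c', by simp [hc', h], h'.symm⟩
  have hcc := isolated_count S hne
  omega

lemma exists_forest (E : Finset (Fin (n + 1) × Fin (m + 1))) :
    ∃ F ⊆ E, F.card + Ncc n m F = n + m + 2 ∧ Ncc n m F = Ncc n m E := by
  classical
  induction E using Finset.induction_on with
  | empty =>
    refine ⟨∅, subset_rfl, ?_, rfl⟩
    apply le_antisymm
    · exact good_card _ (fun S hS hne => absurd (Finset.subset_empty.1 hS) hne.ne_empty)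
    · have : Nat.card (Fin (n + 1) ⊕ Fin (m + 1)) ≤ Ncc n m ∅ := by
        refine Nat.card_le_card_of_injective (coordGraph n m ∅).connectedComponentMk ?_
        intro a b hab
        refine isolated_reach ?_ (SimpleGraph.ConnectedComponent.exact hab)
        intro z; rw [coord_adj]; simp
      simp at this
      simp; omega
  | insert e E he ih =>
    obtain ⟨F, hFE, h1, h2⟩ := ih
    by_cases hr : (coordGraph n m E).Reachable (Sum.inl e.1) (Sum.inr e.2)
    · refine ⟨F, hFE.trans (Finset.subset_insert _ _), h1, h2.trans ?_⟩
      exact (cc_eq (coord_mono (Finset.subset_insert _ _)) (coord_insert E e) hr).symm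
    · have a1 : Ncc n m (insert e E) + 1 ≤ Ncc n m E :=
        cc_lt (coord_mono (Finset.subset_insert _ _)) hr (coord_reach (Finset.mem_insert_self _ _))
      have a2 : Ncc n m (insert e F) + 1 ≤ Ncc n m F :=
        cc_lt (coord_mono (Finset.subset_insert _ _)) (fun h => hr (h.mono (coord_mono hFE)))
          (coord_reach (Finset.mem_insert_self _ _))
      have b1 : Ncc n m E ≤ Ncc n m (insert e E) + 1 :=
        cc_le_succ (coord_mono (Finset.subset_insert _ _)) (coord_insert E e)
      have b2 : Ncc n m F ≤ Ncc n m (insert e F) + 1 :=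
        cc_le_succ (coord_mono (Finset.subset_insert _ _)) (coord_insert F e)
      refine ⟨insert e F, Finset.insert_subset_insert _ hFE, ?_, ?_⟩
      · rw [Finset.card_insert_of_notMem (fun h => he (hFE h))]; omega
      · omega

end Coord

/-- The minimum cardinality `I(E)` of a feedback repair set of `E` equals
`|E| + N_cc(E) − (n + m + 2)`. -/
theorem minFRS_eq_Ncc (n m : ℕ) (hn : 1 ≤ n) (hm : 1 ≤ m)
    (E : Finset (Fin (n + 1) × Fin (m + 1))) :
    (minFRS n m E : ℤ) = (E.card : ℤ) + Ncc n m E - (n + m + 2) := by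
  classical
  obtain ⟨F, hFE, h1, h2⟩ := exists_forest E
  have hmem : (E \ F).card ∈ {k | ∃ E' ⊆ E, IsGood n m (E \ E') ∧ E'.card = k} := by
    refine ⟨E \ F, Finset.sdiff_subset, ?_, rfl⟩
    rw [Finset.sdiff_sdiff_eq_self hFE]
    exact good_of_card F h1.le
  have hle : minFRS n m E ≤ (E \ F).card := Nat.sInf_le hmem
  obtain ⟨E', hE', hg, hk⟩ := Nat.sInf_mem ⟨_, hmem⟩
  change E'.card = minFRS n m E at hk
  have h3 := good_card _ hg
  have h4 : Ncc n m E ≤ Ncc n m (E \ E') := cc_mono (coord_mono Finset.sdiff_subset)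
  have h5 := Finset.card_sdiff_add_card_eq_card hE'
  have h6 := Finset.card_sdiff_add_card_eq_card hFE
  omega
end

section
/- (Kalugin, sparse regime) Let (n_k), (m_k), (e_k) be sequences of positive integers tending to infinity with e_k ≤ N_k := (n_k+1)(m_k+1) and e_k² / ((n_k+1)(m_k+1)) → 0. Then the proportion, among all binom(N_k, e_k) error configurations E of the (n_k+1)×(m_k+1) grid with exactly e_k cells, of those satisfying N_cc(E) = n_k + m_k + 2 − e_k (equivalently, of those whose coordinates graph G_E is a forest) tends to 1 as k → ∞. -/
open Filter Topology

open Finset in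
lemma ks_choose (N e : ℕ) (heN : e ≤ N) (s : ℕ) (hs : s ≤ e) :
    N ^ s * (N - s).choose (e - s) ≤ e ^ s * N.choose e := by
  induction s with
  | zero => simp
  | succ s ih =>
    have ih := ih (by omega)
    obtain ⟨a, ha⟩ : ∃ a, N - s = a + 1 := ⟨N - s - 1, by omega⟩
    obtain ⟨b, hb⟩ : ∃ b, e - s = b + 1 := ⟨e - s - 1, by omega⟩
    have h1 : N - (s+1) = a := by omega
    have h2 : e - (s+1) = b := by omega
    rw [ha, hb] at ih
    rw [h1, h2]
    have h3 := Nat.add_one_mul_choose_eq a b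
    have hN : N = a + 1 + s := by omega
    have he : e = b + 1 + s := by omega
    have hab : b ≤ a := by omega
    have h4 : N * (b+1) ≤ e * (a+1) := by
      rw [hN, he]; nlinarith
    have : (a+1) * (N ^ (s+1) * a.choose b) ≤ (a+1) * (e^(s+1) * N.choose e) := by
      calc (a+1) * (N ^ (s+1) * a.choose b) = N^(s+1) * ((a+1) * a.choose b) := by ring
        _ = (N * (b+1)) * (N^s * (a+1).choose (b+1)) := by rw [h3]; ring
        _ ≤ (e * (a+1)) * (e^s * N.choose e) := Nat.mul_le_mul h4 ih
        _ = _ := by ring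
    exact Nat.le_of_mul_le_mul_left this (by omega)

open Finset in
lemma ks_super {α : Type*} [Fintype α] [DecidableEq α] (S : Finset α) (e : ℕ) :
    ((powersetCard e (univ : Finset α)).filter (fun E => S ⊆ E)).card
      ≤ (Fintype.card α - S.card).choose (e - S.card) := by
  have : (Fintype.card α - S.card).choose (e - S.card)
      = (powersetCard (e - S.card) (univ \ S)).card := by
    rw [card_powersetCard, card_sdiff_of_subset (subset_univ _), card_univ]
  rw [this]
  apply card_le_card_of_injOn (fun E => E \ S)
  · intro E hE
    simp only [coe_filter, mem_powersetCard, Set.mem_ofPred_eq] at hE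
    simp only [mem_coe, mem_powersetCard]
    refine ⟨sdiff_subset_sdiff (subset_univ _) (Subset.refl _), ?_⟩
    rw [card_sdiff_of_subset hE.2, hE.1.2]
  · intro E hE F hF h
    simp only [coe_filter, Set.mem_ofPred_eq] at hE hF
    simp only at h
    rw [← sdiff_union_of_subset hE.2, h, sdiff_union_of_subset hF.2]

lemma ks_adj_lr (n m : ℕ) (E) (i j) :
    (coordGraph n m E).Adj (Sum.inl i) (Sum.inr j) ↔ (i, j) ∈ E := by
  simp [coordGraph]
lemma ks_adj_rl (n m : ℕ) (E) (i j) :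
    (coordGraph n m E).Adj (Sum.inr j) (Sum.inl i) ↔ (i, j) ∈ E := by
  simp [coordGraph]
lemma ks_adj_ll (n m : ℕ) (E) (i j) :
    ¬ (coordGraph n m E).Adj (Sum.inl i) (Sum.inl j) := by
  simp [coordGraph]
lemma ks_adj_rr (n m : ℕ) (E) (i j) :
    ¬ (coordGraph n m E).Adj (Sum.inr i) (Sum.inr j) := by
  simp [coordGraph]

lemma ks_comp {V : Type*} [Finite V] (G G' : SimpleGraph V) (u v : V) (hle : G ≤ G')
    (huv : ¬ G.Reachable u v) (hadj : G'.Adj u v)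
    (h : ∀ a b, G'.Adj a b → G.Adj a b ∨ (a = u ∧ b = v) ∨ (a = v ∧ b = u)) :
    Nat.card G'.ConnectedComponent + 1 = Nat.card G.ConnectedComponent := by
  classical
  have key : ∀ a b, G'.Reachable a b → G.Reachable a b ∨
      (G.Reachable a u ∧ G.Reachable v b) ∨ (G.Reachable a v ∧ G.Reachable u b) := by
    rintro a b ⟨p⟩
    induction p with
    | nil => exact Or.inl (SimpleGraph.Reachable.refl _)
    | @cons a c b hac p ih =>
      rcases h _ _ hac with h1 | ⟨rfl, rfl⟩ | ⟨rfl, rfl⟩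
      · have h1 := h1.reachable
        rcases ih with h2 | ⟨h2, h3⟩ | ⟨h2, h3⟩
        · exact Or.inl (h1.trans h2)
        · exact Or.inr (Or.inl ⟨h1.trans h2, h3⟩)
        · exact Or.inr (Or.inr ⟨h1.trans h2, h3⟩)
      · rcases ih with h2 | ⟨h2, h3⟩ | ⟨h2, h3⟩
        · exact Or.inr (Or.inl ⟨SimpleGraph.Reachable.refl _, h2⟩)
        · exact absurd h2.symm huv
        · exact Or.inl h3
      · rcases ih with h2 | ⟨h2, h3⟩ | ⟨h2, h3⟩
        · exact Or.inr (Or.inr ⟨SimpleGraph.Reachable.refl _, h2⟩)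
        · exact Or.inl h3
        · exact absurd h2 huv
  let f : {c : G.ConnectedComponent // c ≠ G.connectedComponentMk u} → G'.ConnectedComponent :=
    fun c => c.1.map (SimpleGraph.Hom.ofLE hle)
  have hf : Function.Bijective f := by
    constructor
    · rintro ⟨a, ha⟩ ⟨b, hb⟩ hab
      induction a using SimpleGraph.ConnectedComponent.ind with | _ a =>
      induction b using SimpleGraph.ConnectedComponent.ind with | _ b =>
      simp only [f, SimpleGraph.ConnectedComponent.map_mk, SimpleGraph.ConnectedComponent.eq] at hab
      simp only [ne_eq, SimpleGraph.ConnectedComponent.eq] at ha hb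
      apply Subtype.ext
      simp only [SimpleGraph.ConnectedComponent.eq]
      rcases key _ _ hab with h2 | ⟨h2, h3⟩ | ⟨h2, h3⟩
      · exact h2
      · exact absurd h2 ha
      · exact absurd h3.symm hb
    · intro c
      induction c using SimpleGraph.ConnectedComponent.ind with | _ w =>
      by_cases hw : G.Reachable w u
      · refine ⟨⟨G.connectedComponentMk v, ?_⟩, ?_⟩
        · simp only [ne_eq, SimpleGraph.ConnectedComponent.eq]
          exact fun h => huv h.symm
        · simp only [f, SimpleGraph.ConnectedComponent.map_mk, SimpleGraph.ConnectedComponent.eq]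
          exact (hadj.reachable.symm).trans (hw.mono hle).symm
      · refine ⟨⟨G.connectedComponentMk w, ?_⟩, ?_⟩
        · simpa only [ne_eq, SimpleGraph.ConnectedComponent.eq] using hw
        · simp [f]
  have h1 := Nat.card_congr (Equiv.ofBijective f hf)
  have h2 := Nat.card_congr (Equiv.sumCompl (fun c : G.ConnectedComponent => c = G.connectedComponentMk u))
  rw [Nat.card_sum] at h2
  have h3 : Nat.card {c : G.ConnectedComponent // c = G.connectedComponentMk u} = 1 :=
    Nat.card_unique
  rw [← h1, ← h2, h3]
  exact add_comm _ _

lemma ks_forest (n m : ℕ) (E : Finset (Fin (n + 1) × Fin (m + 1))) :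
    (coordGraph n m E).IsAcyclic → Ncc n m E + E.card = n + m + 2 := by
  classical
  induction E using Finset.induction_on with
  | empty =>
    intro _
    have : coordGraph n m ∅ = ⊥ := by
      ext a b; simp [coordGraph]
    have hb : Function.Bijective (coordGraph n m ∅).connectedComponentMk := by
      constructor
      · intro a b h
        rw [SimpleGraph.ConnectedComponent.eq, this, SimpleGraph.reachable_bot] at h
        exact h
      · intro c
        induction c using SimpleGraph.ConnectedComponent.ind with | _ w => exact ⟨w, rfl⟩
    have := Nat.card_congr (Equiv.ofBijective _ hb)
    rw [Ncc, ← this]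
    simp; omega
  | insert c E hc ih =>
    intro hac
    obtain ⟨i, j⟩ := c
    have hle : coordGraph n m E ≤ coordGraph n m (insert (i, j) E) := by
      rintro (a | a) (b | b) h
      · exact absurd h (ks_adj_ll _ _ _ _ _)
      · rw [ks_adj_lr] at h ⊢; exact Finset.mem_insert_of_mem h
      · rw [ks_adj_rl] at h ⊢; exact Finset.mem_insert_of_mem h
      · exact absurd h (ks_adj_rr _ _ _ _ _)
    have hadj : (coordGraph n m (insert (i, j) E)).Adj (Sum.inl i) (Sum.inr j) := by
      rw [ks_adj_lr]; exact Finset.mem_insert_self _ _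
    have ih := ih (hac.anti hle)
    have hbr := SimpleGraph.isAcyclic_iff_forall_isBridge.1 hac
      ((SimpleGraph.mem_edgeSet _).2 hadj)
    rw [SimpleGraph.isBridge_iff] at hbr
    have hnr : ¬ (coordGraph n m E).Reachable (Sum.inl i) (Sum.inr j) := by
      intro hr
      refine hbr (hr.mono ?_)
      intro a b hab
      simp only [SimpleGraph.deleteEdges_adj, SimpleGraph.sdiff_adj, SimpleGraph.fromEdgeSet_adj, Set.mem_singleton_iff]
      refine ⟨hle hab, ?_⟩
      rintro h1
      have h1 : s(a, b) = s(Sum.inl i, Sum.inr j) := by first | exact h1 | exact h1.1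
      have : s(a,b) ∈ (coordGraph n m E).edgeSet := hab
      rw [h1, SimpleGraph.mem_edgeSet, ks_adj_lr] at this
      exact hc this
    have := ks_comp _ _ _ _ hle hnr hadj (by
      rintro (a | a) (b | b) h
      · exact absurd h (ks_adj_ll _ _ _ _ _)
      · rw [ks_adj_lr] at h ⊢
        rcases Finset.mem_insert.1 h with h | h
        · right; left; simpa using h
        · exact Or.inl h
      · rw [ks_adj_rl] at h ⊢
        rcases Finset.mem_insert.1 h with h | h
        · right; right; simpa [and_comm] using h
        · exact Or.inl h
      · exact absurd h (ks_adj_rr _ _ _ _ _))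
    rw [Finset.card_insert_of_notMem hc]
    unfold Ncc at ih ⊢
    omega

/-- cells of the coded cycle -/
def ksCells {n m : ℕ} (l : ℕ) (r : Fin l → Fin (n + 1)) (c : Fin l → Fin (m + 1)) :
    Finset (Fin (n + 1) × Fin (m + 1)) :=
  Finset.univ.image (fun i => (r i, c i)) ∪ Finset.univ.image (fun i => (r (finRotate l i), c i))

lemma ks_cells_card {n m : ℕ} (l : ℕ) (hl : 2 ≤ l) (r : Fin l → Fin (n + 1))
    (c : Fin l → Fin (m + 1)) (hr : Function.Injective r) (hc : Function.Injective c) :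
    (ksCells l r c).card = 2 * l := by
  classical
  unfold ksCells
  rw [Finset.card_union_of_disjoint]
  · rw [Finset.card_image_of_injective, Finset.card_image_of_injective]
    · simp; omega
    · intro a b h; exact hc (Prod.ext_iff.1 h).2
    · intro a b h; exact hc (Prod.ext_iff.1 h).2
  · rw [Finset.disjoint_left]
    intro x hx hy
    simp only [Finset.mem_image, Finset.mem_univ, true_and] at hx hy
    obtain ⟨a, rfl⟩ := hx
    obtain ⟨b, hb⟩ := hy
    have h1 := hc (Prod.ext_iff.1 hb).2
    have h2 := hr (Prod.ext_iff.1 hb).1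
    subst h1
    obtain ⟨k, rfl⟩ : ∃ k, l = k + 2 := ⟨l - 2, by omega⟩
    rw [finRotate_succ_apply] at h2
    simp at h2

lemma ks_cycle_left (n m : ℕ) (E : Finset (Fin (n + 1) × Fin (m + 1)))
    (h : ¬ (coordGraph n m E).IsAcyclic) :
    ∃ i, ∃ p : (coordGraph n m E).Walk (Sum.inl i) (Sum.inl i), p.IsCycle := by
  classical
  unfold SimpleGraph.IsAcyclic at h
  push Not at h
  obtain ⟨v, p, hp⟩ := h
  rcases v with i | j
  · exact ⟨i, p, hp⟩
  · have hadj : (coordGraph n m E).Adj (Sum.inr j) (p.getVert 1) := by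
      have := p.adj_getVert_succ (i := 0) (by have := hp.three_le_length; omega)
      simpa using this
    have hm := p.getVert_mem_support 1
    rcases hv : p.getVert 1 with i | j'
    · rw [hv] at hm
      exact ⟨i, p.rotate _ hm, hp.rotate hm⟩
    · rw [hv] at hadj
      exact absurd hadj (ks_adj_rr _ _ _ _ _)

lemma ks_cycle (n m : ℕ) (E : Finset (Fin (n + 1) × Fin (m + 1)))
    (h : ¬ (coordGraph n m E).IsAcyclic) :
    ∃ l, 2 ≤ l ∧ ∃ (r : Fin l → Fin (n + 1)) (c : Fin l → Fin (m + 1)),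
      Function.Injective r ∧ Function.Injective c ∧ ksCells l r c ⊆ E := by
  obtain ⟨i, p, hp⟩ := ks_cycle_left n m E h
  have h3 := hp.three_le_length
  have par : ∀ k ≤ p.length, (Even k → ∃ a, p.getVert k = Sum.inl a) ∧
      (¬ Even k → ∃ b, p.getVert k = Sum.inr b) := by
    intro k
    induction k with
    | zero => simp
    | succ k ih =>
      intro hk
      have ih := ih (by omega)
      have hadj := p.adj_getVert_succ (i := k) (by omega)
      constructor
      · intro hev
        obtain ⟨b, hb⟩ := ih.2 (by rw [Nat.even_add_one] at hev; exact hev)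
        rw [hb] at hadj
        rcases hv : p.getVert (k+1) with a | a
        · exact ⟨a, rfl⟩
        · rw [hv] at hadj; exact absurd hadj (ks_adj_rr _ _ _ _ _)
      · intro hev
        obtain ⟨b, hb⟩ := ih.1 (by rw [Nat.even_add_one] at hev; exact not_not.1 hev)
        rw [hb] at hadj
        rcases hv : p.getVert (k+1) with a | a
        · rw [hv] at hadj; exact absurd hadj (ks_adj_ll _ _ _ _ _)
        · exact ⟨a, rfl⟩
  have hL : Even p.length := by
    by_contra hne
    obtain ⟨b, hb⟩ := (par _ le_rfl).2 hne
    simp at hb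
  obtain ⟨l, hl⟩ := hL
  have hr : ∀ t : Fin l, ∃ a, p.getVert (2 * t.1) = Sum.inl a := fun t =>
    (par _ (by omega)).1 (by simp)
  have hc : ∀ t : Fin l, ∃ a, p.getVert (2 * t.1 + 1) = Sum.inr a := fun t =>
    (par _ (by omega)).2 (by simp)
  choose r hr using hr
  choose c hc using hc
  refine ⟨l, by omega, r, c, ?_, ?_, ?_⟩
  · intro a b hab
    have := hp.getVert_injOn' (x₁ := 2 * a.1) (x₂ := 2 * b.1)
      (by simp only [Set.mem_ofPred_eq]; omega) (by simp only [Set.mem_ofPred_eq]; omega)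
      (by rw [hr, hr, hab])
    ext; omega
  · intro a b hab
    have := hp.getVert_injOn' (x₁ := 2 * a.1 + 1) (x₂ := 2 * b.1 + 1)
      (by simp only [Set.mem_ofPred_eq]; omega) (by simp only [Set.mem_ofPred_eq]; omega)
      (by rw [hc, hc, hab])
    ext; omega
  · intro x hx
    unfold ksCells at hx
    simp only [Finset.mem_union, Finset.mem_image, Finset.mem_univ, true_and] at hx
    rcases hx with ⟨a, rfl⟩ | ⟨a, rfl⟩
    · have := p.adj_getVert_succ (i := 2 * a.1) (by omega)
      rw [hr, hc, ks_adj_lr] at this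
      exact this
    · have h1 := p.adj_getVert_succ (i := 2 * a.1 + 1) (by omega)
      have h2 : p.getVert (2 * a.1 + 1 + 1) = Sum.inl (r (finRotate l a)) := by
        obtain ⟨k, rfl⟩ : ∃ k, l = k + 1 := ⟨l - 1, by omega⟩
        rw [← hr]
        by_cases hlast : a = Fin.last k
        · subst hlast
          have : 2 * (Fin.last k).1 + 1 + 1 = p.length := by simp; omega
          rw [this]; simp
        · rw [coe_finRotate_of_ne_last hlast]; rfl
      rw [h2, hc, ks_adj_rl] at h1
      exact h1

open Finset in
lemma ks_bad (n m e : ℕ) (he : e ≤ (n + 1) * (m + 1)) (x : ℝ)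
    (hx : x = (e : ℝ) ^ 2 / ((n + 1) * (m + 1))) (hx1 : x < 1) :
    (({E : Finset (Fin (n + 1) × Fin (m + 1)) |
            E.card = e ∧ ¬ (coordGraph n m E).IsAcyclic}.ncard : ℝ)) ≤
      x / (1 - x) * ((n + 1) * (m + 1)).choose e := by
  classical
  set N := (n + 1) * (m + 1) with hN
  have hNR : ((n : ℝ) + 1) * (m + 1) = N := by rw [hN]; push_cast; ring
  rw [hNR] at hx
  have hNpos : (0 : ℝ) < N := by rw [← hNR]; positivity
  have hx0 : 0 ≤ x := by rw [hx]; positivity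
  let T : (l : ℕ) → Finset ((Fin l → Fin (n + 1)) × (Fin l → Fin (m + 1))) := fun l =>
    univ.filter (fun q => (ksCells l q.1 q.2).card = 2 * l)
  let B : Finset (Finset (Fin (n + 1) × Fin (m + 1))) :=
    (Ico 1 (e + 1)).biUnion (fun l => if 2 * l ≤ e then (T l).biUnion (fun q =>
      (powersetCard e univ).filter (fun E => ksCells l q.1 q.2 ⊆ E)) else ∅)
  have hsub : {E : Finset (Fin (n + 1) × Fin (m + 1)) |
            E.card = e ∧ ¬ (coordGraph n m E).IsAcyclic} ⊆ (B : Set _) := by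
    rintro E ⟨hE, hac⟩
    obtain ⟨l, hl, r, c, hr, hc, hs⟩ := ks_cycle n m E hac
    have hcard := ks_cells_card l hl r c hr hc
    have hle := card_le_card hs
    rw [hcard, hE] at hle
    simp only [B, mem_coe, mem_biUnion, mem_Ico]
    refine ⟨l, by omega, ?_⟩
    rw [if_pos hle]
    simp only [mem_biUnion]
    exact ⟨(r, c), by simp [T, hcard], by simp [hE, hs]⟩
  have h1 := Set.ncard_le_ncard hsub (finite_toSet _)
  rw [Set.ncard_coe_finset] at h1
  have h2 : (B.card : ℝ) ≤ ∑ l ∈ Ico 1 (e + 1), x ^ l * N.choose e := by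
    refine le_trans (Nat.cast_le.2 card_biUnion_le) ?_
    push_cast
    apply sum_le_sum
    intro l hl
    split_ifs with h2l
    · have hb : ((T l).biUnion (fun q =>
        (powersetCard e univ).filter (fun E => ksCells l q.1 q.2 ⊆ E))).card
          ≤ N ^ l * (N - 2 * l).choose (e - 2 * l) := by
        refine card_biUnion_le.trans ?_
        have : ∀ q ∈ T l, ((powersetCard e univ).filter (fun E => ksCells l q.1 q.2 ⊆ E)).card
            ≤ (N - 2 * l).choose (e - 2 * l) := by
          intro q hq
          have hq : (ksCells l q.1 q.2).card = 2 * l := by simpa [T] using hq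
          have := ks_super (ksCells l q.1 q.2) e
          rw [hq] at this
          simpa [hN] using this
        refine (sum_le_sum this).trans ?_
        rw [sum_const, smul_eq_mul]
        apply Nat.mul_le_mul_right
        refine (card_le_univ _).trans ?_
        simp [hN, mul_pow]
      have hch := ks_choose N e he (2 * l) h2l
      have hbR : (((T l).biUnion (fun q =>
        (powersetCard e univ).filter (fun E => ksCells l q.1 q.2 ⊆ E))).card : ℝ)
          ≤ (N : ℝ) ^ l * ((N - 2 * l).choose (e - 2 * l) : ℕ) := by exact_mod_cast hb
      have hchR : (N : ℝ) ^ (2 * l) * ((N - 2 * l).choose (e - 2 * l) : ℕ)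
        ≤ (e : ℝ) ^ (2 * l) * (N.choose e : ℕ) := by exact_mod_cast hch
      refine hbR.trans ?_
      rw [hx, div_pow, ← pow_mul, div_mul_eq_mul_div, le_div_iff₀ (by positivity)]
      refine le_trans (le_of_eq ?_) hchR
      ring
    · simp; positivity
  rw [← sum_mul] at h2
  refine le_trans (by exact_mod_cast h1) (h2.trans ?_)
  apply mul_le_mul_of_nonneg_right _ (by positivity)
  rw [geom_sum_Ico' hx1.ne (by omega)]
  apply div_le_div_of_nonneg_right _ (by linarith)
  simp; positivity

/-- Kalugin, sparse regime: if `e_k² / ((n_k+1)(m_k+1)) → 0`, the proportion of `e_k`-cell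
configurations with `N_cc = n_k + m_k + 2 − e_k` (i.e. whose coordinates graph is a forest)
tends to `1`. -/
theorem kalugin_sparse (n m e : ℕ → ℕ)
    (hn : Tendsto n atTop atTop) (hm : Tendsto m atTop atTop) (he : Tendsto e atTop atTop)
    (hpos : ∀ k, 0 < n k ∧ 0 < m k ∧ 0 < e k)
    (hle : ∀ k, e k ≤ (n k + 1) * (m k + 1))
    (hsparse : Tendsto (fun k => ((e k : ℝ) ^ 2 / ((n k + 1) * (m k + 1)))) atTop (nhds 0)) :
    Tendsto
      (fun k =>
        (({E : Finset (Fin (n k + 1) × Fin (m k + 1)) |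
            E.card = e k ∧ (Ncc (n k) (m k) E : ℤ) = n k + m k + 2 - e k}.ncard : ℝ)) /
          (Nat.choose ((n k + 1) * (m k + 1)) (e k) : ℝ))
      atTop (nhds 1) := by
  set x : ℕ → ℝ := fun k => ((e k : ℝ) ^ 2 / ((n k + 1) * (m k + 1))) with hx
  have hlow : Tendsto (fun k => 1 - x k / (1 - x k)) atTop (nhds 1) := by
    have : Tendsto (fun k => 1 - x k / (1 - x k)) atTop (nhds (1 - 0 / (1 - 0))) :=
      tendsto_const_nhds.sub (hsparse.div (tendsto_const_nhds.sub hsparse) (by norm_num))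
    simpa using this
  have hev : ∀ᶠ k in atTop, x k < 1 := hsparse.eventually_lt_const one_pos
  have hcp : ∀ k, (0 : ℝ) < (Nat.choose ((n k + 1) * (m k + 1)) (e k) : ℝ) := fun k => by
    exact_mod_cast Nat.choose_pos (hle k)
  have htot : ∀ k, {E : Finset (Fin (n k + 1) × Fin (m k + 1)) | E.card = e k}.ncard
      = Nat.choose ((n k + 1) * (m k + 1)) (e k) := by
    intro k
    have : {E : Finset (Fin (n k + 1) × Fin (m k + 1)) | E.card = e k}
        = ((Finset.powersetCard (e k) Finset.univ :
          Finset (Finset (Fin (n k + 1) × Fin (m k + 1)))) : Set _) := by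
      ext E; simp
    rw [this, Set.ncard_coe_finset, Finset.card_powersetCard]
    simp
  refine tendsto_of_tendsto_of_tendsto_of_le_of_le' hlow tendsto_const_nhds ?_ ?_
  · filter_upwards [hev] with k hk
    rw [le_div_iff₀ (hcp k)]
    have hb := ks_bad (n k) (m k) (e k) (hle k) (x k) rfl hk
    have hu : {E : Finset (Fin (n k + 1) × Fin (m k + 1)) | E.card = e k} ⊆
        {E : Finset (Fin (n k + 1) × Fin (m k + 1)) |
            E.card = e k ∧ (Ncc (n k) (m k) E : ℤ) = n k + m k + 2 - e k} ∪
        {E : Finset (Fin (n k + 1) × Fin (m k + 1)) |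
            E.card = e k ∧ ¬ (coordGraph (n k) (m k) E).IsAcyclic} := by
      intro E hE
      have hE : E.card = e k := hE
      by_cases hac : (coordGraph (n k) (m k) E).IsAcyclic
      · left
        refine ⟨hE, ?_⟩
        have := ks_forest _ _ E hac
        omega
      · right
        exact ⟨hE, hac⟩
    have h1 := (Set.ncard_le_ncard hu (Set.toFinite _)).trans (Set.ncard_union_le _ _)
    rw [htot] at h1
    have h1R : (Nat.choose ((n k + 1) * (m k + 1)) (e k) : ℝ) ≤ _ := Nat.cast_le.2 h1
    rw [Nat.cast_add] at h1R
    linarith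
  · filter_upwards with k
    rw [div_le_one (hcp k), ← htot k]
    refine Nat.cast_le.2 (Set.ncard_le_ncard ?_ (Set.toFinite _))
    intro E hE
    exact hE.1
end

section
/- (Kalugin, critical regime) Let (n_k), (m_k), (e_k) be sequences of positive integers tending to infinity with e_k ≤ N_k := (n_k+1)(m_k+1), such that e_k = Θ(n_k), e_k = Θ(m_k) (i.e. there exist constants 0 < a ≤ b with a·n_k ≤ e_k ≤ b·n_k and a·m_k ≤ e_k ≤ b·m_k for all k), and e_k² / ((n_k+1)(m_k+1)) → c for some c ∈ (0,1). Set λ := −(ln(1−c) + c)/2. Then for every fixed integer j ≥ 0, the proportion, among all binom(N_k, e_k) error configurations E with exactly e_k cells, of those satisfying N_cc(E) = n_k + m_k + 2 − e_k + j tends to λ^j·exp(−λ)/j! as k → ∞. -/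
open Filter Topology

namespace SimpleGraph
lemma kal_reach_sup_edge {V : Type*} (G : SimpleGraph V) (s t a b : V) :
    (G ⊔ edge s t).Reachable a b →
      G.Reachable a b ∨ (G.Reachable a s ∧ G.Reachable t b) ∨ (G.Reachable a t ∧ G.Reachable s b) := by
  rintro ⟨w⟩
  induction w with
  | nil => exact Or.inl (Reachable.refl _)
  | @cons u v w h p ih =>
    rw [sup_adj] at h
    rcases h with h | h
    · have h' : G.Reachable u v := h.reachable
      rcases ih with ih | ⟨h1, h2⟩ | ⟨h1, h2⟩
      · exact Or.inl (h'.trans ih)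
      · exact Or.inr (Or.inl ⟨h'.trans h1, h2⟩)
      · exact Or.inr (Or.inr ⟨h'.trans h1, h2⟩)
    · rw [edge_adj] at h
      rcases h.1 with ⟨rfl, rfl⟩ | ⟨rfl, rfl⟩
      · rcases ih with ih | ⟨h1, h2⟩ | ⟨h1, h2⟩
        · exact Or.inr (Or.inl ⟨Reachable.refl _, ih⟩)
        · exact Or.inr (Or.inl ⟨Reachable.refl _, h2⟩)
        · exact Or.inl h2
      · rcases ih with ih | ⟨h1, h2⟩ | ⟨h1, h2⟩
        · exact Or.inr (Or.inr ⟨Reachable.refl _, ih⟩)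
        · exact Or.inl h2
        · exact Or.inr (Or.inr ⟨Reachable.refl _, h2⟩)

lemma kal_card_cc_of_reach {V : Type*} [Finite V] (G : SimpleGraph V) (s t : V) (h : G.Reachable s t) :
    Nat.card (G ⊔ edge s t).ConnectedComponent = Nat.card G.ConnectedComponent := by
  symm
  apply Nat.card_eq_of_bijective (ConnectedComponent.map (Hom.ofLE (le_sup_left : G ≤ G ⊔ edge s t)))
  refine ⟨?_, ConnectedComponent.surjective_map_ofLE _⟩
  intro c d
  induction c using ConnectedComponent.ind
  induction d using ConnectedComponent.ind
  simp only [ConnectedComponent.map_mk, ConnectedComponent.eq]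
  intro h'
  rcases kal_reach_sup_edge G s t _ _ h' with h1 | ⟨h1, h2⟩ | ⟨h1, h2⟩
  · exact h1
  · exact h1.trans (h.trans h2)
  · exact h1.trans (h.symm.trans h2)

lemma kal_card_cc_of_not_reach {V : Type*} [Finite V] (G : SimpleGraph V) (s t : V)
    (h : ¬ G.Reachable s t) :
    Nat.card (G ⊔ edge s t).ConnectedComponent + 1 = Nat.card G.ConnectedComponent := by
  classical
  have hst : s ≠ t := fun h' => h (h' ▸ Reachable.refl _)
  have e : Nat.card {c : G.ConnectedComponent // c ≠ G.connectedComponentMk t}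
      = Nat.card (G ⊔ edge s t).ConnectedComponent := by
    apply Nat.card_eq_of_bijective
      (fun c => ConnectedComponent.map (Hom.ofLE (le_sup_left : G ≤ G ⊔ edge s t)) c.1)
    refine ⟨?_, ?_⟩
    · rintro ⟨c, hc⟩ ⟨d, hd⟩ hcd
      induction c using ConnectedComponent.ind
      induction d using ConnectedComponent.ind
      simp only [ConnectedComponent.map_mk, ConnectedComponent.eq, Subtype.mk.injEq, ne_eq] at *
      rcases kal_reach_sup_edge G s t _ _ hcd with h1 | ⟨h1, h2⟩ | ⟨h1, h2⟩
      · exact h1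
      · exact absurd (ConnectedComponent.eq.2 h2.symm) hd
      · exact absurd (ConnectedComponent.eq.2 h1) hc
    · intro d
      induction d using ConnectedComponent.ind with
      | _ v =>
      by_cases hv : G.Reachable v t
      · refine ⟨⟨G.connectedComponentMk s, by simpa [ConnectedComponent.eq] using h⟩, ?_⟩
        simp only [ConnectedComponent.map_mk, ConnectedComponent.eq]
        have h1 : (G ⊔ edge s t).Reachable s t :=
          Adj.reachable (by simp [sup_adj, edge_adj, hst])
        exact h1.trans (hv.mono le_sup_left).symm
      · exact ⟨⟨G.connectedComponentMk v, by simpa [ConnectedComponent.eq] using hv⟩, rfl⟩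
  rw [← e]
  have := Fintype.ofFinite G.ConnectedComponent
  rw [Nat.card_eq_fintype_card, Nat.card_eq_fintype_card, Fintype.card_subtype_compl]
  simp only [Fintype.card_unique]
  have : 0 < Fintype.card G.ConnectedComponent :=
    Fintype.card_pos_iff.mpr ⟨G.connectedComponentMk t⟩
  omega
end SimpleGraph

namespace Kal
variable {n m : ℕ}

abbrev Cell (n m : ℕ) := Fin (n + 1) × Fin (m + 1)

/-- endpoints of a cell are connected -/
def Conn (E : Finset (Cell n m)) (x : Cell n m) : Prop :=
  (coordGraph n m E).Reachable (Sum.inl x.1) (Sum.inr x.2)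

lemma adj_iff (E : Finset (Cell n m)) (u v) : (coordGraph n m E).Adj u v ↔
    ∃ i j, (i, j) ∈ E ∧ ((u = Sum.inl i ∧ v = Sum.inr j) ∨ (u = Sum.inr j ∧ v = Sum.inl i)) := by
  unfold coordGraph
  rw [SimpleGraph.fromRel_adj]
  constructor
  · rintro ⟨-, ⟨i, j, h1, h2, h3⟩ | ⟨i, j, h1, h2, h3⟩⟩
    · exact ⟨i, j, h3, Or.inl ⟨h1, h2⟩⟩
    · exact ⟨i, j, h3, Or.inr ⟨h2, h1⟩⟩
  · rintro ⟨i, j, h, ⟨rfl, rfl⟩ | ⟨rfl, rfl⟩⟩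
    · exact ⟨by simp, Or.inl ⟨i, j, rfl, rfl, h⟩⟩
    · exact ⟨by simp, Or.inr ⟨i, j, rfl, rfl, h⟩⟩

lemma adj_lr (E : Finset (Cell n m)) (i j) :
    (coordGraph n m E).Adj (Sum.inl i) (Sum.inr j) ↔ (i, j) ∈ E := by
  rw [adj_iff]; simp

lemma graph_mono {E F : Finset (Cell n m)} (h : E ⊆ F) : coordGraph n m E ≤ coordGraph n m F := by
  intro u v
  rw [adj_iff, adj_iff]
  rintro ⟨i, j, h1, h2⟩
  exact ⟨i, j, h h1, h2⟩

lemma graph_insert (E : Finset (Cell n m)) (x : Cell n m) :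
    coordGraph n m (insert x E) = coordGraph n m E ⊔ SimpleGraph.edge (Sum.inl x.1) (Sum.inr x.2) := by
  ext u v
  rw [SimpleGraph.sup_adj, adj_iff, adj_iff, SimpleGraph.edge_adj]
  constructor
  · rintro ⟨i, j, h, h'⟩
    rw [Finset.mem_insert] at h
    rcases h with rfl | h
    · right; rcases h' with ⟨rfl, rfl⟩ | ⟨rfl, rfl⟩ <;> simp
    · exact Or.inl ⟨i, j, h, h'⟩
  · rintro (⟨i, j, h, h'⟩ | ⟨h, -⟩)
    · exact ⟨i, j, Finset.mem_insert_of_mem h, h'⟩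
    · exact ⟨x.1, x.2, Finset.mem_insert_self _ _, by rcases h with ⟨rfl, rfl⟩ | ⟨rfl, rfl⟩ <;> simp⟩

lemma Ncc_insert_conn (E : Finset (Cell n m)) (x) (h : Conn E x) :
    Ncc n m (insert x E) = Ncc n m E := by
  unfold Ncc; rw [graph_insert]; exact SimpleGraph.kal_card_cc_of_reach _ _ _ h

lemma Ncc_insert_not_conn (E : Finset (Cell n m)) (x) (h : ¬ Conn E x) :
    Ncc n m (insert x E) + 1 = Ncc n m E := by
  unfold Ncc; rw [graph_insert]; exact SimpleGraph.kal_card_cc_of_not_reach _ _ _ h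

lemma conn_of_mem {E : Finset (Cell n m)} {x} (h : x ∈ E) : Conn E x :=
  SimpleGraph.Adj.reachable ((adj_lr E x.1 x.2).2 h)

lemma Ncc_empty : Ncc n m (∅ : Finset (Cell n m)) = n + m + 2 := by
  have h : coordGraph n m (∅ : Finset (Cell n m)) = ⊥ := by
    ext u v; rw [adj_iff]; simp
  unfold Ncc
  rw [h]
  have : Nat.card (Fin (n+1) ⊕ Fin (m+1)) = Nat.card (⊥ : SimpleGraph (Fin (n+1) ⊕ Fin (m+1))).ConnectedComponent := by
    apply Nat.card_eq_of_bijective (fun v => SimpleGraph.connectedComponentMk _ v)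
    refine ⟨?_, ?_⟩
    · intro a b hab
      simpa [SimpleGraph.ConnectedComponent.eq] using hab
    · intro c
      induction c using SimpleGraph.ConnectedComponent.ind with
      | _ v => exact ⟨v, rfl⟩
  rw [← this]
  simp; ring

/-- cyclomatic number -/
noncomputable def Z (E : Finset (Cell n m)) : ℕ := Ncc n m E + E.card - (n + m + 2)

lemma Z_spec (E : Finset (Cell n m)) : Z E + (n + m + 2) = Ncc n m E + E.card := by
  have : n + m + 2 ≤ Ncc n m E + E.card := by
    induction E using Finset.induction_on with
    | empty => simp [Ncc_empty]
    | insert x E hx ih =>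
      rw [Finset.card_insert_of_notMem hx]
      by_cases h : Conn E x
      · rw [Ncc_insert_conn E x h]; omega
      · have := Ncc_insert_not_conn E x h; omega
  unfold Z; omega

lemma Z_empty : Z (∅ : Finset (Cell n m)) = 0 := by
  have := Z_spec (∅ : Finset (Cell n m)); rw [Ncc_empty] at this; simp at this; omega

lemma Z_insert_conn {E : Finset (Cell n m)} {x} (hx : x ∉ E) (h : Conn E x) :
    Z (insert x E) = Z E + 1 := by
  have h1 := Z_spec E; have h2 := Z_spec (insert x E)
  rw [Finset.card_insert_of_notMem hx, Ncc_insert_conn E x h] at h2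
  omega

lemma Z_insert_not_conn {E : Finset (Cell n m)} {x} (hx : x ∉ E) (h : ¬ Conn E x) :
    Z (insert x E) = Z E := by
  have h1 := Z_spec E; have h2 := Z_spec (insert x E)
  have h3 := Ncc_insert_not_conn E x h
  rw [Finset.card_insert_of_notMem hx] at h2
  omega

/-- If a set of vertices is connected in `F`, then it has at most `|F|+1-Z` elements. -/
lemma card_touch_le (F : Finset (Cell n m)) (T : Finset (Fin (n+1) ⊕ Fin (m+1)))
    (v0) (hT : ∀ v ∈ T, (coordGraph n m F).Reachable v0 v) :
    T.card + Z F ≤ F.card + 1 := by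
  have h1 := Z_spec F
  have h2 : Ncc n m F ≤ (n + m + 2) - T.card + 1 := by
    unfold Ncc
    have : Nat.card (coordGraph n m F).ConnectedComponent ≤ Nat.card (Option {v // v ∈ Tᶜ}) := by
      apply Nat.card_le_card_of_surjective
        (fun o => match o with
          | none => (coordGraph n m F).connectedComponentMk v0
          | some v => (coordGraph n m F).connectedComponentMk v.1)
      intro c
      induction c using SimpleGraph.ConnectedComponent.ind with
      | _ v =>
      by_cases hv : v ∈ T
      · refine ⟨none, ?_⟩
        simpa [SimpleGraph.ConnectedComponent.eq] using hT v hv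
      · exact ⟨some ⟨v, by simpa using hv⟩, rfl⟩
    refine this.trans (le_of_eq ?_)
    rw [Nat.card_eq_fintype_card, Fintype.card_option, Fintype.card_coe, Finset.card_compl]
    simp; omega
  have h3 : T.card ≤ n + m + 2 := by
    refine (Finset.card_le_univ T).trans (le_of_eq ?_)
    simp; ring
  omega

lemma Z_pos_of_not_acyclic (F : Finset (Cell n m)) (h : ¬ (coordGraph n m F).IsAcyclic) :
    1 ≤ Z F := by
  rw [SimpleGraph.isAcyclic_iff_forall_adj_isBridge] at h
  push Not at h
  obtain ⟨u, v, huv, hb⟩ := h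
  obtain ⟨i, j, hij, h'⟩ := (adj_iff F u v).1 huv
  have key : Conn (F.erase (i, j)) (i, j) := by
    have hle : (coordGraph n m F) \ SimpleGraph.fromEdgeSet {s(u, v)} ≤ coordGraph n m (F.erase (i,j)) := by
      intro a b hab
      rw [SimpleGraph.sdiff_adj, SimpleGraph.fromEdgeSet_adj] at hab
      obtain ⟨h1, h2⟩ := hab
      obtain ⟨i', j', h3, h4⟩ := (adj_iff F a b).1 h1
      rw [adj_iff]
      refine ⟨i', j', ?_, h4⟩
      rw [Finset.mem_erase]
      refine ⟨?_, h3⟩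
      intro h5
      simp only [Prod.mk.injEq] at h5
      obtain ⟨rfl, rfl⟩ := h5
      apply h2
      refine ⟨?_, h1.ne⟩
      rcases h' with ⟨rfl, rfl⟩ | ⟨rfl, rfl⟩ <;> rcases h4 with ⟨rfl, rfl⟩ | ⟨rfl, rfl⟩ <;> simp
    rw [SimpleGraph.isBridge_iff] at hb
    have hr : (coordGraph n m (F.erase (i,j))).Reachable u v := by
      by_contra hc
      exact hb (fun hr => hc (SimpleGraph.Reachable.mono hle hr))
    rcases h' with ⟨rfl, rfl⟩ | ⟨rfl, rfl⟩
    · exact hr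
    · exact hr.symm
  have := Z_insert_conn (Finset.notMem_erase _ _) key
  rw [Finset.insert_erase hij] at this
  omega

end Kal


namespace Kal
variable {n m : ℕ}

abbrev PIx (n m l : ℕ) := (Fin (l + 1) → Fin (n + 1)) × (Fin (l + 1) → Fin (m + 1))

def cells {l : ℕ} (π : PIx n m l) : Finset (Cell n m) :=
  (Finset.univ.image fun i : Fin (l + 1) => (π.1 i, π.2 i)) ∪
    (Finset.univ.image fun i : Fin l => (π.1 i.succ, π.2 i.castSucc))

def ends {l : ℕ} (π : PIx n m l) : Cell n m := (π.1 0, π.2 (Fin.last l))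

open Classical in
noncomputable def paths (n m l : ℕ) : Finset (PIx n m l) :=
  (Finset.univ.filter fun f : Fin (l + 1) → Fin (n + 1) => Function.Injective f) ×ˢ
  (Finset.univ.filter fun f : Fin (l + 1) → Fin (m + 1) => Function.Injective f)

lemma mem_paths {l : ℕ} {π : PIx n m l} :
    π ∈ paths n m l ↔ Function.Injective π.1 ∧ Function.Injective π.2 := by
  simp [paths]

lemma card_inj (l k : ℕ) : 
    (open Classical in (Finset.univ.filter fun f : Fin l → Fin k => Function.Injective f).card) =
      k.descFactorial l := by
  classical
  rw [← Fintype.card_subtype, Fintype.card_congr (Equiv.subtypeInjectiveEquivEmbedding (Fin l) (Fin k)),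
    Fintype.card_embedding_eq]
  simp

lemma card_paths (l : ℕ) : (paths n m l).card =
    (n + 1).descFactorial (l + 1) * (m + 1).descFactorial (l + 1) := by
  unfold paths
  rw [Finset.card_product, card_inj, card_inj]

lemma card_cells {l : ℕ} {π : PIx n m l} (h : π ∈ paths n m l) : (cells π).card = 2 * l + 1 := by
  rw [mem_paths] at h
  unfold cells
  rw [Finset.card_union_of_disjoint, Finset.card_image_of_injective, Finset.card_image_of_injective]
  · simp; ring
  · intro a b hab
    simp only [Prod.mk.injEq] at hab
    exact Fin.castSucc_injective _ (h.2 hab.2)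
  · intro a b hab
    simp only [Prod.mk.injEq] at hab
    exact (h.2 hab.2)
  · rw [Finset.disjoint_left]
    intro x h1 h2
    simp only [Finset.mem_image, Finset.mem_univ, true_and] at h1 h2
    obtain ⟨i, rfl⟩ := h1
    obtain ⟨k, hk⟩ := h2
    simp only [Prod.mk.injEq] at hk
    have h3 := h.1 hk.1
    have h4 := h.2 hk.2
    rw [← h3] at h4
    simp [Fin.ext_iff] at h4

lemma cells_diag {l : ℕ} (π : PIx n m l) (i) : (π.1 i, π.2 i) ∈ cells π :=
  Finset.mem_union_left _ (Finset.mem_image_of_mem (fun i => (π.1 i, π.2 i)) (Finset.mem_univ i))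

lemma cells_off {l : ℕ} (π : PIx n m l) (i : Fin l) : (π.1 i.succ, π.2 i.castSucc) ∈ cells π :=
  Finset.mem_union_right _ (Finset.mem_image_of_mem
    (fun i : Fin l => (π.1 i.succ, π.2 i.castSucc)) (Finset.mem_univ i))

lemma reach_cells {l : ℕ} (π : PIx n m l) (E : Finset (Cell n m)) (h : cells π ⊆ E) (i : Fin (l + 1)) :
    (coordGraph n m E).Reachable (Sum.inl (π.1 0)) (Sum.inl (π.1 i)) ∧
    (coordGraph n m E).Reachable (Sum.inl (π.1 0)) (Sum.inr (π.2 i)) := by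
  have hd : ∀ i, (coordGraph n m E).Reachable (Sum.inl (π.1 i)) (Sum.inr (π.2 i)) := fun i =>
    SimpleGraph.Adj.reachable ((adj_lr E _ _).2 (h (cells_diag π i)))
  have ho : ∀ i : Fin l, (coordGraph n m E).Reachable (Sum.inl (π.1 i.succ)) (Sum.inr (π.2 i.castSucc)) :=
    fun i => SimpleGraph.Adj.reachable ((adj_lr E _ _).2 (h (cells_off π i)))
  have : (coordGraph n m E).Reachable (Sum.inl (π.1 0)) (Sum.inl (π.1 i)) := by
    induction i using Fin.induction with
    | zero => exact SimpleGraph.Reachable.refl _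
    | succ i ih => exact (ih.trans (hd _)).trans (ho i).symm
  exact ⟨this, this.trans (hd i)⟩

lemma exists_walk (E : Finset (Cell n m)) : ∀ (l : ℕ) (π : PIx n m l) (_ : cells π ⊆ E),
    ∃ w : (coordGraph n m E).Walk (Sum.inl (π.1 0)) (Sum.inr (π.2 (Fin.last l))),
      w.length = 2 * l + 1 ∧ ∀ i : Fin (l + 1),
        w.getVert (2 * i.1) = Sum.inl (π.1 i) ∧ w.getVert (2 * i.1 + 1) = Sum.inr (π.2 i) := by
  intro l
  induction l with
  | zero =>
    intro π h
    refine ⟨SimpleGraph.Walk.cons ((adj_lr E _ _).2 (h (cells_diag π 0))) SimpleGraph.Walk.nil, ?_, ?_⟩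
    · simp
    · intro i
      have : i = 0 := by ext; simp
      subst this
      simp
  | succ l ih =>
    intro π h
    obtain ⟨w, hw1, hw2⟩ := ih (π.1 ∘ Fin.succ, π.2 ∘ Fin.succ) (by
      intro x hx
      apply h
      simp only [cells, Finset.mem_union, Finset.mem_image, Finset.mem_univ, true_and] at hx ⊢
      rcases hx with ⟨i, rfl⟩ | ⟨i, rfl⟩
      · exact Or.inl ⟨i.succ, rfl⟩
      · exact Or.inr ⟨i.succ, rfl⟩)
    have h1 : (coordGraph n m E).Adj (Sum.inl (π.1 0)) (Sum.inr (π.2 0)) :=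
      (adj_lr E _ _).2 (h (cells_diag π 0))
    have h2 : (coordGraph n m E).Adj (Sum.inr (π.2 0)) (Sum.inl (π.1 (Fin.succ 0))) :=
      ((adj_lr E _ _).2 (h (cells_off π 0))).symm
    refine ⟨SimpleGraph.Walk.cons h1 (SimpleGraph.Walk.cons h2 w), ?_, ?_⟩
    · rw [SimpleGraph.Walk.length_cons, SimpleGraph.Walk.length_cons]
      have hw1' : SimpleGraph.Walk.length (u := Sum.inl (π.1 (Fin.succ 0))) w = 2 * l + 1 := hw1
      omega
    · intro i
      refine Fin.cases ?_ (fun i => ?_) i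
      · simp
      · have e1 : 2 * (i.succ).1 = 2 * i.1 + 1 + 1 := by simp; ring
        rw [e1]
        simp only [SimpleGraph.Walk.getVert_cons_succ]
        exact hw2 i

abbrev SP (n m : ℕ) := Σ l : ℕ, PIx n m l

def scells (P : SP n m) := cells P.2
def sends (P : SP n m) := ends P.2
def SInj (P : SP n m) : Prop := Function.Injective P.2.1 ∧ Function.Injective P.2.2

lemma fin_two_mul {l : ℕ} (k : ℕ) (hk : k ≤ 2 * l + 1) :
    ∃ i : Fin (l + 1), k = 2 * i.1 ∨ k = 2 * i.1 + 1 :=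
  ⟨⟨k / 2, by omega⟩, by simp only; omega⟩

lemma path_unique (E : Finset (Cell n m)) (hE : (coordGraph n m E).IsAcyclic) (P Q : SP n m)
    (hP : SInj P) (hQ : SInj Q) (hPE : scells P ⊆ E) (hQE : scells Q ⊆ E)
    (he : sends P = sends Q) : P = Q := by
  obtain ⟨l, π⟩ := P
  obtain ⟨l', ρ⟩ := Q
  have hpath : ∀ (l : ℕ) (π : PIx n m l), SInj (⟨l, π⟩ : SP n m) → 
      ∀ {a b} (w : (coordGraph n m E).Walk a b), w.length = 2 * l + 1 →
      (∀ i : Fin (l + 1),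
        w.getVert (2 * i.1) = Sum.inl (π.1 i) ∧ w.getVert (2 * i.1 + 1) = Sum.inr (π.2 i)) → w.IsPath := by
    intro l π hπ a b w hw h
    rw [← SimpleGraph.Walk.IsPath.getVert_injOn_iff]
    intro k hk k' hk' hkk
    simp only [Set.mem_ofPred_eq, hw] at hk hk'
    obtain ⟨i, hi⟩ := fin_two_mul k hk
    obtain ⟨i', hi'⟩ := fin_two_mul k' hk'
    rcases hi with rfl | rfl <;> rcases hi' with rfl | rfl
    · rw [(h i).1, (h i').1] at hkk
      rw [hπ.1 (Sum.inl_injective hkk)]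
    · rw [(h i).1, (h i').2] at hkk; simp at hkk
    · rw [(h i).2, (h i').1] at hkk; simp at hkk
    · rw [(h i).2, (h i').2] at hkk
      rw [hπ.2 (Sum.inr_injective hkk)]
  obtain ⟨w, hw1, hw2⟩ := exists_walk E l π hPE
  obtain ⟨w', hw1', hw2'⟩ := exists_walk E l' ρ hQE
  have p1 := hpath l π hP w hw1 hw2
  have p2 := hpath l' ρ hQ w' hw1' hw2'
  simp only [sends, ends, Prod.mk.injEq] at he
  obtain ⟨w'', hlen, hget⟩ : ∃ w'' : (coordGraph n m E).Walk (Sum.inl (π.1 0)) (Sum.inr (π.2 (Fin.last l))),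
      w''.length = w'.length ∧ ∀ k, w''.getVert k = w'.getVert k := by
    rw [he.1, he.2]; exact ⟨w', rfl, fun _ => rfl⟩
  have p3 := hpath l' ρ hQ w'' (hlen.trans hw1') (fun i => by rw [hget, hget]; exact hw2' i)
  have heq := congrArg Subtype.val (hE.path_unique ⟨w, p1⟩ ⟨w'', p3⟩)
  simp only at heq
  subst heq
  have : l = l' := by omega
  subst this
  have : π = ρ := by
    apply Prod.ext <;> funext i
    · have h1 := (hw2 i).1
      rw [hget, (hw2' i).1] at h1
      exact (Sum.inl_injective h1).symm
    · have h1 := (hw2 i).2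
      rw [hget, (hw2' i).2] at h1
      exact (Sum.inr_injective h1).symm
  rw [this]

lemma getVert_parity (E : Finset (Cell n m)) {a b} (w : (coordGraph n m E).Walk a b) (i : Fin (n+1)) (ha : a = Sum.inl i)
    (k : ℕ) (hk : k ≤ w.length) : (w.getVert k).isLeft = decide (Even k) := by
  induction k with
  | zero => simp [ha]
  | succ k ih =>
    have h1 := ih (by omega)
    have h2 := w.adj_getVert_succ (i := k) (by omega)
    rw [adj_iff] at h2
    obtain ⟨i, j, -, ⟨h3, h4⟩ | ⟨h3, h4⟩⟩ := h2
    · rw [h3] at h1; rw [h4]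
      simp at h1 ⊢; grind
    · rw [h3] at h1; rw [h4]
      simp at h1 ⊢; grind

lemma exists_path (E : Finset (Cell n m)) (x : Cell n m) (h : Conn E x) :
    ∃ P : SP n m, P.1 ≤ n ∧ SInj P ∧ scells P ⊆ E ∧ sends P = x := by
  classical
  obtain ⟨w0⟩ := h
  obtain ⟨w, hw⟩ := w0.toPath
  have hodd : ¬ Even w.length := by
    have := getVert_parity E w x.1 rfl w.length le_rfl
    simpa using this
  obtain ⟨l, hl⟩ := Nat.not_even_iff_odd.1 hodd
  have hinj := hw.getVert_injOn
  have hL : ∀ i : Fin (l + 1), ∃ r, w.getVert (2 * i.1) = Sum.inl r := by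
    intro i
    have := getVert_parity E w x.1 rfl (2 * i.1) (by omega)
    simp only [even_two, Even.mul_right, decide_true] at this
    exact Sum.isLeft_iff.1 this
  have hR : ∀ i : Fin (l + 1), ∃ r, w.getVert (2 * i.1 + 1) = Sum.inr r := by
    intro i
    have := getVert_parity E w x.1 rfl (2 * i.1 + 1) (by omega)
    have h2 : ¬ Even (2 * i.1 + 1) := by simp
    simp only [h2, decide_false] at this
    exact Sum.isRight_iff.1 (by simpa using this)
  choose u hu using hL
  choose v hv using hR
  have hui : Function.Injective u := by
    intro i i' h
    have := hinj (x₁ := 2 * i.1) (x₂ := 2 * i'.1) (by simp; omega) (by simp; omega) (by rw [hu, hu, h])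
    ext; omega
  have hvi : Function.Injective v := by
    intro i i' h
    have := hinj (x₁ := 2 * i.1 + 1) (x₂ := 2 * i'.1 + 1) (by simp; omega) (by simp; omega) (by rw [hv, hv, h])
    ext; omega
  refine ⟨⟨l, u, v⟩, ?_, ⟨hui, hvi⟩, ?_, ?_⟩
  · have := Fintype.card_le_of_injective u hui
    simp at this; exact this
  · intro y hy
    simp only [scells, cells, Finset.mem_union, Finset.mem_image, Finset.mem_univ, true_and] at hy
    rcases hy with ⟨i, rfl⟩ | ⟨i, rfl⟩
    · rw [← adj_lr, ← hu, ← hv]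
      exact w.adj_getVert_succ (by omega)
    · rw [← adj_lr, ← hu, ← hv]
      have := w.adj_getVert_succ (i := 2 * i.1 + 1) (by omega)
      exact this.symm
  · simp only [sends, ends]
    apply Prod.ext
    · have := hu 0
      simp at this
      simp [this]
    · have := hv (Fin.last l)
      simp only [Fin.val_last] at this
      rw [← hl, SimpleGraph.Walk.getVert_length] at this
      exact (Sum.inr_injective this).symm

noncomputable def spaths (n m L : ℕ) : Finset (SP n m) :=
  (Finset.range (L + 1)).sigma (fun l => paths n m l)

lemma mem_spaths {L : ℕ} {P : SP n m} : P ∈ spaths n m L ↔ P.1 ≤ L ∧ SInj P := by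
  simp [spaths, mem_paths, SInj]

open Classical in
noncomputable def S (E : Finset (Cell n m)) : ℕ := (Finset.univ.filter fun x => Conn E x).card

open Classical in
noncomputable def Y (L : ℕ) (E : Finset (Cell n m)) : ℕ :=
  ((spaths n m L).filter fun P => scells P ⊆ E).card

open Classical in
noncomputable def W (L : ℕ) (E : Finset (Cell n m)) : ℕ :=
  ((spaths n m L ×ˢ spaths n m L).filter fun PQ =>
    PQ.1 ≠ PQ.2 ∧ sends PQ.1 = sends PQ.2 ∧ scells PQ.1 ∪ scells PQ.2 ⊆ E).card

lemma S_le_Y (E : Finset (Cell n m)) : S E ≤ Y n E := by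
  classical
  unfold S Y
  apply Finset.card_le_card_of_surjOn sends
  intro x hx
  simp only [Finset.coe_filter, Finset.mem_univ, true_and, Set.mem_ofPred_eq] at hx
  obtain ⟨P, h1, h2, h3, h4⟩ := exists_path E x hx
  refine ⟨P, ?_, h4⟩
  simp [mem_spaths, h1, h2, h3]

lemma Y_le_S_add_W (L : ℕ) (E : Finset (Cell n m)) : Y L E ≤ S E + W L E := by
  classical
  set B : Cell n m → Finset (SP n m) := fun x =>
    (spaths n m L).filter fun P => scells P ⊆ E ∧ sends P = x with hB
  have hY : Y L E = ∑ x, (B x).card := by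
    unfold Y
    rw [Finset.card_eq_sum_card_fiberwise (f := sends) (t := Finset.univ) (by intro x _; simp)]
    apply Finset.sum_congr rfl
    intro x _
    rw [Finset.filter_filter]
  have hW : W L E = ∑ x, (B x).offDiag.card := by
    unfold W
    rw [Finset.card_eq_sum_card_fiberwise (f := fun PQ => sends PQ.1) (t := Finset.univ) (by intro x _; simp)]
    apply Finset.sum_congr rfl
    intro x _
    congr 1
    ext ⟨P, Q⟩
    simp only [Finset.mem_filter, Finset.mem_product, Finset.mem_offDiag, hB, Finset.union_subset_iff]
    constructor
    · rintro ⟨⟨⟨h1, h2⟩, h3, h4, h5, h6⟩, h7⟩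
      exact ⟨⟨h1, h5, h7⟩, ⟨h2, h6, h4 ▸ h7⟩, h3⟩
    · rintro ⟨⟨h1, h5, h7⟩, ⟨h2, h6, h8⟩, h3⟩
      exact ⟨⟨⟨h1, h2⟩, h3, h7.trans h8.symm, h5, h6⟩, h7⟩
  have hS : S E = ∑ x, if Conn E x then 1 else 0 := by
    unfold S; rw [Finset.card_filter]
  rw [hY, hW, hS, ← Finset.sum_add_distrib]
  apply Finset.sum_le_sum
  intro x _
  rw [Finset.offDiag_card]
  rcases Nat.lt_or_ge (B x).card 2 with h | h
  · rcases Nat.eq_zero_or_pos (B x).card with h0 | h0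
    · rw [h0]; simp
    · obtain ⟨P, hP⟩ := Finset.card_pos.1 h0
      simp only [hB, Finset.mem_filter] at hP
      have : Conn E x := by
        rw [← hP.2.2]
        exact (reach_cells P.2 E hP.2.1 (Fin.last _)).2
      rw [if_pos this]; omega
  · have : 2 * (B x).card ≤ (B x).card * (B x).card := Nat.mul_le_mul_right _ h
    omega

lemma Y_mono_sub (L : ℕ) (hL : L ≤ n) (E : Finset (Cell n m)) : Y L E ≤ Y n E := by
  classical
  unfold Y
  apply Finset.card_le_card
  intro P
  simp only [Finset.mem_filter, mem_spaths]
  rintro ⟨⟨h1, h2⟩, h3⟩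
  exact ⟨⟨h1.trans hL, h2⟩, h3⟩

end Kal


namespace Kal
variable {n m : ℕ}

noncomputable def avg (t : ℕ) (f : Finset (Cell n m) → ℝ) : ℝ :=
  (∑ E ∈ Finset.powersetCard t Finset.univ, f E) / (((n + 1) * (m + 1)).choose t : ℝ)

lemma card_cell : Fintype.card (Cell n m) = (n + 1) * (m + 1) := by simp

lemma avg_mono (t : ℕ) {f g : Finset (Cell n m) → ℝ} (h : ∀ E, E.card = t → f E ≤ g E) :
    avg t f ≤ avg t g := by
  unfold avg
  gcongr with E hE
  exact h E (Finset.mem_powersetCard.1 hE).2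

lemma avg_congr (t : ℕ) {f g : Finset (Cell n m) → ℝ} (h : ∀ E, E.card = t → f E = g E) :
    avg t f = avg t g := by
  unfold avg
  congr 1
  apply Finset.sum_congr rfl
  intro E hE
  exact h E (Finset.mem_powersetCard.1 hE).2

lemma avg_add (t : ℕ) (f g : Finset (Cell n m) → ℝ) :
    avg t (fun E => f E + g E) = avg t f + avg t g := by
  unfold avg; rw [Finset.sum_add_distrib, add_div]

lemma avg_sub (t : ℕ) (f g : Finset (Cell n m) → ℝ) :
    avg t (fun E => f E - g E) = avg t f - avg t g := by
  unfold avg; rw [Finset.sum_sub_distrib, sub_div]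

lemma avg_mul (t : ℕ) (c : ℝ) (f : Finset (Cell n m) → ℝ) :
    avg t (fun E => c * f E) = c * avg t f := by
  unfold avg; rw [← Finset.mul_sum, mul_div_assoc]

lemma avg_sum {ι : Type*} (s : Finset ι) (t : ℕ) (f : ι → Finset (Cell n m) → ℝ) :
    avg t (fun E => ∑ i ∈ s, f i E) = ∑ i ∈ s, avg t (f i) := by
  unfold avg; rw [Finset.sum_comm, Finset.sum_div]

lemma choose_pos' {t : ℕ} (ht : t ≤ (n + 1) * (m + 1)) : (0:ℝ) < (((n + 1) * (m + 1)).choose t : ℝ) := by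
  exact_mod_cast Nat.choose_pos ht

lemma avg_const {t : ℕ} (ht : t ≤ (n + 1) * (m + 1)) (c : ℝ) :
    avg (n := n) (m := m) t (fun _ => c) = c := by
  unfold avg
  rw [Finset.sum_const, Finset.card_powersetCard, Finset.card_univ, card_cell, nsmul_eq_mul,
    mul_div_cancel_left₀ _ (choose_pos' ht).ne']

lemma abs_avg_le (t : ℕ) (f : Finset (Cell n m) → ℝ) : |avg t f| ≤ avg t (fun E => |f E|) := by
  unfold avg
  rw [abs_div, abs_of_nonneg (by positivity : (0:ℝ) ≤ (((n + 1) * (m + 1)).choose t : ℝ))]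
  gcongr
  exact Finset.abs_sum_le_sum_abs _ _

lemma avg_abs_le_sqrt {t : ℕ} (ht : t ≤ (n + 1) * (m + 1)) (f : Finset (Cell n m) → ℝ) :
    avg t (fun E => |f E|) ≤ √(avg t (fun E => f E ^ 2)) := by
  apply Real.le_sqrt_of_sq_le
  unfold avg
  have h := sq_sum_le_card_mul_sum_sq (s := Finset.powersetCard t (Finset.univ : Finset (Cell n m)))
    (f := fun E => |f E|)
  rw [Finset.card_powersetCard, Finset.card_univ, card_cell] at h
  simp only [sq_abs] at h
  have hp := choose_pos' ht
  rw [div_pow, div_le_div_iff₀ (by positivity) hp]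
  nlinarith

lemma avg_ind {t : ℕ} (ht : t ≤ (n + 1) * (m + 1)) (F : Finset (Cell n m)) :
    (open Classical in avg t (fun E => if F ⊆ E then (1:ℝ) else 0)) =
      (t.descFactorial F.card : ℝ) / (((n + 1) * (m + 1)).descFactorial F.card : ℝ) := by
  classical
  have hF : F.card ≤ (n + 1) * (m + 1) := by rw [← card_cell]; exact Finset.card_le_univ F
  have hD : (0:ℝ) < (((n + 1) * (m + 1)).descFactorial F.card : ℝ) := by
    exact_mod_cast Nat.descFactorial_pos.2 hF
  unfold avg
  rw [← Finset.sum_filter, Finset.sum_const, nsmul_eq_mul, mul_one,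
    div_eq_div_iff (choose_pos' ht).ne' hD.ne']
  by_cases h : F.card ≤ t
  · have h1 := Finset.card_filter_powersetCard_subset F Finset.univ t (Finset.subset_univ _) h
    rw [Finset.card_univ, card_cell] at h1
    have h2 := Nat.choose_mul (n := (n + 1) * (m + 1)) h
    rw [Nat.descFactorial_eq_factorial_mul_choose, Nat.descFactorial_eq_factorial_mul_choose]
    have h3 : (((Finset.powersetCard t Finset.univ).filter (fun E => F ⊆ E)).card : ℝ) =
      (((n + 1) * (m + 1) - F.card).choose (t - F.card) : ℝ) := by
      rw [← h1]
    rw [h3]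
    have h4 : (((n + 1) * (m + 1)).choose t : ℝ) * (t.choose F.card : ℝ) = (((n + 1) * (m + 1)).choose F.card : ℝ)
      * (((n + 1) * (m + 1) - F.card).choose (t - F.card) : ℝ) := by exact_mod_cast h2
    push_cast
    linear_combination (-(F.card.factorial : ℝ)) * h4
  · push Not at h
    rw [Nat.descFactorial_of_lt h]
    have : ((Finset.powersetCard t Finset.univ).filter (fun E => F ⊆ E)) = ∅ := by
      rw [Finset.filter_eq_empty_iff]
      intro E hE hFE
      have := Finset.card_le_card hFE
      rw [(Finset.mem_powersetCard.1 hE).2] at this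
      omega
    rw [this]; simp

lemma desc_div_le {t N : ℕ} (ht : t ≤ N) (f : ℕ) :
    (t.descFactorial f : ℝ) / (N.descFactorial f : ℝ) ≤ ((t : ℝ) / N) ^ f := by
  induction f with
  | zero => simp
  | succ f ih =>
    rw [Nat.descFactorial_succ, Nat.descFactorial_succ, pow_succ']
    push_cast
    rw [mul_div_mul_comm]
    apply mul_le_mul _ ih (by positivity) (by positivity)
    rcases Nat.lt_or_ge f t with h | h
    · have h1 : ((t - f : ℕ) : ℝ) = t - f := by push_cast [h.le]; ring
      have h2 : ((N - f : ℕ) : ℝ) = N - f := by push_cast [(h.le.trans ht)]; ring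
      rw [h1, h2]
      have h3 : (f : ℝ) < t := by exact_mod_cast h
      have h4 : (t : ℝ) ≤ N := by exact_mod_cast ht
      have h5 : (0:ℝ) ≤ f := by positivity
      rw [div_le_div_iff₀ (by linarith) (by linarith)]
      nlinarith
    · rw [Nat.sub_eq_zero_of_le h]; simp; positivity

lemma prob_le {t e : ℕ} (hte : t ≤ e) (he : e ≤ (n + 1) * (m + 1)) (F : Finset (Cell n m)) :
    (open Classical in avg t (fun E => if F ⊆ E then (1:ℝ) else 0)) ≤
      ((e : ℝ) / (((n + 1) * (m + 1) : ℕ) : ℝ)) ^ F.card := by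
  rw [avg_ind (hte.trans he)]
  refine (desc_div_le (hte.trans he) _).trans ?_
  gcongr

lemma desc_ratio_ge {a k : ℕ} (ha : 0 < a) :
    1 - (k : ℝ) ^ 2 / a ≤ (a.descFactorial k : ℝ) / (a : ℝ) ^ k := by
  have ha' : (0:ℝ) < a := by exact_mod_cast ha
  rcases Nat.lt_or_ge a k with h | h
  · have h1 : (a:ℝ) < k := by exact_mod_cast h
    have h0 : (1:ℝ) ≤ k := by
      have : 1 ≤ k := by omega
      exact_mod_cast this
    have : 1 ≤ (k:ℝ)^2 / a := by rw [le_div_iff₀ ha']; nlinarith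
    have h2 : 0 ≤ (a.descFactorial k : ℝ) / (a : ℝ) ^ k := by positivity
    linarith
  · have h1 : (((a + 1 - k : ℕ) : ℝ)) ^ k ≤ (a.descFactorial k : ℝ) := by
      exact_mod_cast Nat.pow_sub_le_descFactorial a k
    have h2 : ((a + 1 - k : ℕ) : ℝ) = a + 1 - k := by
      push_cast [(by omega : k ≤ a + 1)]; ring
    rw [h2] at h1
    have hk : (k:ℝ) ≤ a := by exact_mod_cast h
    have h3 : (1 - (k:ℝ) / a) ^ k ≤ ((a + 1 - k : ℝ) / a) ^ k := by
      have : (0:ℝ) ≤ 1 - (k:ℝ) / a := by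
        rw [sub_nonneg, div_le_one ha']; exact hk
      apply pow_le_pow_left₀ this
      rw [le_div_iff₀ ha', sub_mul, div_mul_cancel₀ _ ha'.ne']; linarith
    have h4 := one_add_mul_le_pow (a := -((k:ℝ)/a)) (by
      have : (k:ℝ)/a ≤ 1 := by rw [div_le_one ha']; exact hk
      linarith) k
    calc 1 - (k : ℝ) ^ 2 / a = 1 + k * (-((k:ℝ)/a)) := by ring
      _ ≤ (1 - (k:ℝ)/a)^k := by rw [sub_eq_add_neg]; exact h4
      _ ≤ _ := h3
      _ = (a + 1 - k : ℝ)^k / a ^ k := div_pow _ _ _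
      _ ≤ _ := by gcongr

lemma desc_ratio_le {a k : ℕ} :
    (a.descFactorial k : ℝ) / (a : ℝ) ^ k ≤ 1 := by
  apply div_le_one_of_le₀ _ (by positivity)
  exact_mod_cast Nat.descFactorial_le_pow a k

/-- target for the expected number of connected pairs -/
noncomputable def yy (L : ℕ) (N : ℕ) (t : ℕ) : ℝ :=
  ∑ l ∈ Finset.range (L + 1), (t : ℝ) * ((t : ℝ) ^ 2 / N) ^ l

/-- expected number of paths of a given length -/
noncomputable def EP (n m l t : ℕ) : ℝ :=
  ((n + 1).descFactorial (l + 1) * (m + 1).descFactorial (l + 1) : ℝ) *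
    ((t.descFactorial (2 * l + 1) : ℝ) / (((n + 1) * (m + 1)).descFactorial (2 * l + 1) : ℝ))

lemma EP_le {l t : ℕ} (ht : t ≤ (n + 1) * (m + 1)) :
    EP n m l t ≤ (t : ℝ) * ((t : ℝ) ^ 2 / (((n + 1) * (m + 1) : ℕ) : ℝ)) ^ l := by
  unfold EP
  have hN : (0:ℝ) < (((n + 1) * (m + 1) : ℕ) : ℝ) := by positivity
  have h1 := desc_div_le ht (2 * l + 1)
  have h2 : ((n + 1).descFactorial (l + 1) * (m + 1).descFactorial (l + 1) : ℝ) ≤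
      (((n + 1) * (m + 1) : ℕ) : ℝ) ^ (l + 1) := by
    rw [Nat.cast_mul, mul_pow]
    gcongr
    · exact_mod_cast Nat.descFactorial_le_pow _ _
    · exact_mod_cast Nat.descFactorial_le_pow _ _
  refine (mul_le_mul h2 h1 (by positivity) (by positivity)).trans (le_of_eq ?_)
  generalize (((n + 1) * (m + 1) : ℕ) : ℝ) = N at *
  rw [div_pow, div_pow]
  field_simp
  ring

lemma EP_ge {l t : ℕ} (ht : t ≤ (n + 1) * (m + 1)) (hc : (t : ℝ) ^ 2 ≤ (((n + 1) * (m + 1) : ℕ) : ℝ)) (β : ℝ)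
    (h1 : (t : ℝ) ≤ β * (n + 1)) (h2 : (t : ℝ) ≤ β * (m + 1)) :
    (t : ℝ) * ((t : ℝ) ^ 2 / (((n + 1) * (m + 1) : ℕ) : ℝ)) ^ l - (2 * l + 1) ^ 2 * (2 * β + 1) ≤ EP n m l t := by
  have hβ : 0 ≤ β := by
    by_contra hb
    push Not at hb
    have : β * (n + 1) < 0 := by
      apply mul_neg_of_neg_of_pos hb; positivity
    have : (0:ℝ) ≤ t := by positivity
    linarith
  rcases Nat.eq_zero_or_pos t with rfl | htp
  · have : 0 ≤ EP n m l 0 := by unfold EP; positivity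
    have h : (0:ℝ) ≤ (2 * l + 1) ^ 2 * (2 * β + 1) := by positivity
    simp; linarith
  have htR : (0:ℝ) < t := by exact_mod_cast htp
  set N : ℕ := (n + 1) * (m + 1) with hN
  have hNp : (0:ℝ) < (N : ℝ) := by rw [hN]; positivity
  set X := (t : ℝ) * ((t : ℝ) ^ 2 / N) ^ l with hX
  have hXt : X ≤ t := by
    rw [hX]
    have : ((t : ℝ) ^ 2 / N) ^ l ≤ 1 := by
      apply pow_le_one₀ (by positivity)
      rw [div_le_one hNp]; exact hc
    nlinarith
  have hX0 : 0 ≤ X := by positivity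
  set d1 := ((n + 1).descFactorial (l + 1) : ℝ) / ((n + 1 : ℕ) : ℝ) ^ (l + 1) with hd1
  set d2 := ((m + 1).descFactorial (l + 1) : ℝ) / ((m + 1 : ℕ) : ℝ) ^ (l + 1) with hd2
  set d3 := (t.descFactorial (2 * l + 1) : ℝ) / (t : ℝ) ^ (2 * l + 1) with hd3
  have g1 : 1 - ((2 * l + 1 : ℝ)) ^ 2 / (n + 1) ≤ d1 := by
    have := desc_ratio_ge (a := n + 1) (k := l + 1) (by omega)
    refine le_trans ?_ this
    push_cast
    gcongr
    linarith [(by positivity : (0:ℝ) ≤ l)]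
  have g2 : 1 - ((2 * l + 1 : ℝ)) ^ 2 / (m + 1) ≤ d2 := by
    have := desc_ratio_ge (a := m + 1) (k := l + 1) (by omega)
    refine le_trans ?_ this
    push_cast
    gcongr
    linarith [(by positivity : (0:ℝ) ≤ l)]
  have g3 : 1 - ((2 * l + 1 : ℝ)) ^ 2 / t ≤ d3 := by
    have := desc_ratio_ge (a := t) (k := 2 * l + 1) htp
    push_cast at this
    exact this
  have l1 : d1 ≤ 1 := desc_ratio_le
  have l2 : d2 ≤ 1 := desc_ratio_le
  have l3 : d3 ≤ 1 := desc_ratio_le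
  have p1 : 0 ≤ d1 := by positivity
  have p2 : 0 ≤ d2 := by positivity
  have p3 : 0 ≤ d3 := by positivity
  have hprod : 1 - ((1 - d1) + (1 - d2) + (1 - d3)) ≤ d1 * d2 * d3 := by
    have a1 : d1 + d2 - 1 ≤ d1 * d2 := by nlinarith
    have a2 : d1 * d2 ≤ 1 := by nlinarith
    nlinarith [mul_nonneg p1 p2]
  have hEP : X * (d1 * d2 * d3) ≤ EP n m l t := by
    have hle : (t.descFactorial (2 * l + 1) : ℝ) / (N : ℝ) ^ (2 * l + 1) ≤
        (t.descFactorial (2 * l + 1) : ℝ) / (N.descFactorial (2 * l + 1) : ℝ) := by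
      rcases Nat.lt_or_ge N (2 * l + 1) with h | h
      · rw [Nat.descFactorial_of_lt (by omega : t < 2 * l + 1)]; simp
      · have : (0:ℝ) < (N.descFactorial (2 * l + 1) : ℝ) := by
          exact_mod_cast Nat.descFactorial_pos.2 h
        gcongr
        exact_mod_cast Nat.descFactorial_le_pow _ _
    unfold EP
    refine le_trans (le_of_eq ?_) (mul_le_mul_of_nonneg_left hle (by positivity))
    have hNc : (N : ℝ) = ((n + 1 : ℕ) : ℝ) * ((m + 1 : ℕ) : ℝ) := by rw [hN]; push_cast; ring
    have hA : (0:ℝ) < ((n + 1 : ℕ) : ℝ) := by positivity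
    have hB : (0:ℝ) < ((m + 1 : ℕ) : ℝ) := by positivity
    rw [hX, hd1, hd2, hd3, hNc]
    generalize ((n + 1 : ℕ) : ℝ) = A at hA ⊢
    generalize ((m + 1 : ℕ) : ℝ) = B at hB ⊢
    generalize ((n + 1).descFactorial (l + 1) : ℝ) = D1
    generalize ((m + 1).descFactorial (l + 1) : ℝ) = D2
    generalize (t.descFactorial (2 * l + 1) : ℝ) = D3
    simp only [div_pow, mul_pow]
    field_simp
    ring
  refine le_trans ?_ hEP
  have b1 : X * (1 - d1) ≤ (2 * l + 1 : ℝ) ^ 2 * β := by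
    calc X * (1 - d1) ≤ t * ((2 * l + 1 : ℝ) ^ 2 / (n + 1)) :=
          mul_le_mul hXt (by linarith) (by linarith) htR.le
      _ = (2 * l + 1 : ℝ) ^ 2 * (t / (n + 1)) := by ring
      _ ≤ _ := by
        gcongr
        rw [div_le_iff₀ (by positivity)]; exact h1
  have b2 : X * (1 - d2) ≤ (2 * l + 1 : ℝ) ^ 2 * β := by
    calc X * (1 - d2) ≤ t * ((2 * l + 1 : ℝ) ^ 2 / (m + 1)) :=
          mul_le_mul hXt (by linarith) (by linarith) htR.le
      _ = (2 * l + 1 : ℝ) ^ 2 * (t / (m + 1)) := by ring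
      _ ≤ _ := by
        gcongr
        rw [div_le_iff₀ (by positivity)]; exact h2
  have b3 : X * (1 - d3) ≤ (2 * l + 1 : ℝ) ^ 2 := by
    calc X * (1 - d3) ≤ t * ((2 * l + 1 : ℝ) ^ 2 / t) :=
          mul_le_mul hXt (by linarith) (by linarith) htR.le
      _ = (2 * l + 1 : ℝ) ^ 2 := by field_simp
  nlinarith [mul_le_mul_of_nonneg_left hprod hX0]

lemma sum_pow_image_fin {V : Type*} [Fintype V] [DecidableEq V] (p : ℝ) (hp : 0 ≤ p) (s : ℕ) :
    ∀ k, k ≤ s → ∑ g : Fin k → V, p ^ (Finset.univ.image g).card ≤ (p * Fintype.card V + s) ^ k := by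
  intro k
  induction k with
  | zero => intro _; simp
  | succ k ih =>
    intro hk
    rw [← Fintype.sum_equiv (Fin.consEquiv (fun _ : Fin (k + 1) => V))
      (fun ag => p ^ (insert ag.1 (Finset.univ.image ag.2)).card) _ (by
        intro ag
        congr 2
        ext x
        simp [Fin.consEquiv, Fin.exists_fin_succ, eq_comm])]
    rw [Fintype.sum_prod_type, Finset.sum_comm]
    calc ∑ g : Fin k → V, ∑ a : V, p ^ (insert a (Finset.univ.image g)).card
        ≤ ∑ g : Fin k → V, (p * Fintype.card V + s) * p ^ (Finset.univ.image g).card := by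
          apply Finset.sum_le_sum
          intro g _
          set I := Finset.univ.image g with hI
          have hIk : (I.card : ℝ) ≤ s := by
            have : I.card ≤ k := by
              refine Finset.card_image_le.trans ?_; simp
            exact_mod_cast this.trans (by omega)
          calc ∑ a : V, p ^ (insert a I).card ≤
              ∑ a : V, (p * p ^ I.card + (if a ∈ I then p ^ I.card else 0)) := by
                apply Finset.sum_le_sum
                intro a _
                by_cases ha : a ∈ I
                · rw [Finset.insert_eq_of_mem ha, if_pos ha]
                  have : 0 ≤ p * p ^ I.card := by positivity
                  linarith
                · rw [Finset.card_insert_of_notMem ha, if_neg ha, pow_succ']; simp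
            _ = p * Fintype.card V * p ^ I.card + I.card * p ^ I.card := by
                rw [Finset.sum_add_distrib]
                simp
                ring
            _ ≤ _ := by
                have : 0 ≤ p ^ I.card := by positivity
                nlinarith
      _ = (p * Fintype.card V + s) * ∑ g : Fin k → V, p ^ (Finset.univ.image g).card := by
          rw [Finset.mul_sum]
      _ ≤ (p * Fintype.card V + s) * (p * Fintype.card V + s) ^ k := by
          gcongr
          exact ih (by omega)
      _ = _ := by rw [pow_succ']

lemma sum_pow_image_two (R k k' : ℕ) (p : ℝ) (hp : 0 ≤ p) :
    ∑ g : (Fin k → Fin R) × (Fin k' → Fin R),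
      p ^ (Finset.univ.image g.1 ∪ Finset.univ.image g.2).card ≤ (p * R + (k + k' : ℕ)) ^ (k + k') := by
  have h := sum_pow_image_fin (V := Fin R) p hp (k + k') (k + k') le_rfl
  rw [Fintype.card_fin] at h
  refine le_trans (le_of_eq ?_) h
  symm
  apply Fintype.sum_equiv ((Equiv.arrowCongr finSumFinEquiv.symm (Equiv.refl _)).trans
    (Equiv.sumArrowEquivProdArrow (Fin k) (Fin k') (Fin R)))
  intro g
  congr 2
  ext x
  simp only [Finset.mem_image, Finset.mem_univ, true_and, Finset.mem_union]
  constructor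
  · rintro ⟨i, rfl⟩
    obtain ⟨j, rfl⟩ := finSumFinEquiv.surjective i
    rcases j with j | j
    · exact Or.inl ⟨j, rfl⟩
    · exact Or.inr ⟨j, rfl⟩
  · rintro (⟨i, rfl⟩ | ⟨i, rfl⟩)
    · exact ⟨_, rfl⟩
    · exact ⟨_, rfl⟩

end Kal


namespace Kal
variable {n m : ℕ}

def vert {l l' : ℕ} (π : PIx n m l) (ρ : PIx n m l') : ℕ :=
  (Finset.univ.image π.1 ∪ Finset.univ.image ρ.1).card +
  (Finset.univ.image π.2 ∪ Finset.univ.image ρ.2).card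

lemma vert_le {l l' : ℕ} (π : PIx n m l) (ρ : PIx n m l')
    (h : (coordGraph n m (cells π ∪ cells ρ)).Reachable (Sum.inl (π.1 0)) (Sum.inl (ρ.1 0))) :
    vert π ρ + Z (cells π ∪ cells ρ) ≤ (cells π ∪ cells ρ).card + 1 := by
  have := card_touch_le (cells π ∪ cells ρ)
    ((Finset.univ.image π.1 ∪ Finset.univ.image ρ.1).disjSum
      (Finset.univ.image π.2 ∪ Finset.univ.image ρ.2)) (Sum.inl (π.1 0)) (by
    intro v hv
    have h1 := reach_cells π (cells π ∪ cells ρ) Finset.subset_union_left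
    have h2 := reach_cells ρ (cells π ∪ cells ρ) Finset.subset_union_right
    rw [Finset.mem_disjSum] at hv
    rcases hv with ⟨a, ha, rfl⟩ | ⟨a, ha, rfl⟩
    · simp only [Finset.mem_union, Finset.mem_image, Finset.mem_univ, true_and] at ha
      rcases ha with ⟨i, rfl⟩ | ⟨i, rfl⟩
      · exact (h1 i).1
      · exact h.trans (h2 i).1
    · simp only [Finset.mem_union, Finset.mem_image, Finset.mem_univ, true_and] at ha
      rcases ha with ⟨i, rfl⟩ | ⟨i, rfl⟩
      · exact (h1 i).2
      · exact h.trans (h2 i).2)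
  rw [Finset.card_disjSum] at this
  exact this

lemma reach_of_not_disjoint {l l' : ℕ} (π : PIx n m l) (ρ : PIx n m l')
    (h : ¬ Disjoint (cells π) (cells ρ)) :
    (coordGraph n m (cells π ∪ cells ρ)).Reachable (Sum.inl (π.1 0)) (Sum.inl (ρ.1 0)) := by
  rw [Finset.not_disjoint_iff] at h
  obtain ⟨x, hx1, hx2⟩ := h
  have aux : ∀ (l : ℕ) (π : PIx n m l), x ∈ cells π → ∃ i, x.1 = π.1 i := by
    intro l π hx
    simp only [cells, Finset.mem_union, Finset.mem_image, Finset.mem_univ, true_and] at hx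
    rcases hx with ⟨i, rfl⟩ | ⟨i, rfl⟩
    · exact ⟨_, rfl⟩
    · exact ⟨_, rfl⟩
  obtain ⟨i, hi⟩ := aux _ _ hx1
  obtain ⟨j, hj⟩ := aux _ _ hx2
  have h1 := (reach_cells π (cells π ∪ cells ρ) Finset.subset_union_left i).1
  have h2 := (reach_cells ρ (cells π ∪ cells ρ) Finset.subset_union_right j).1
  rw [← hi] at h1
  rw [← hj] at h2
  exact h1.trans h2.symm

lemma pair_sum_le (l l' : ℕ) (p β : ℝ) (hp : 0 ≤ p) (h1 : p * (n + 1) ≤ β) (h2 : p * (m + 1) ≤ β) :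
    ∑ π ∈ paths n m l, ∑ ρ ∈ paths n m l', p ^ vert π ρ ≤
      (β + ((l + 1) + (l' + 1) : ℕ)) ^ ((l + 1) + (l' + 1)) * (β + ((l + 1) + (l' + 1) : ℕ)) ^ ((l + 1) + (l' + 1)) := by
  calc ∑ π ∈ paths n m l, ∑ ρ ∈ paths n m l', p ^ vert π ρ
      ≤ ∑ π : PIx n m l, ∑ ρ : PIx n m l', p ^ vert π ρ := by
        refine (Finset.sum_le_sum fun π _ => Finset.sum_le_sum_of_subset_of_nonneg
          (Finset.subset_univ _) (fun _ _ _ => by positivity)).trans ?_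
        exact Finset.sum_le_sum_of_subset_of_nonneg (Finset.subset_univ _)
          (fun _ _ _ => Finset.sum_nonneg fun _ _ => by positivity)
    _ = (∑ g : (Fin (l+1) → Fin (n+1)) × (Fin (l'+1) → Fin (n+1)),
          p ^ (Finset.univ.image g.1 ∪ Finset.univ.image g.2).card) *
        (∑ g : (Fin (l+1) → Fin (m+1)) × (Fin (l'+1) → Fin (m+1)),
          p ^ (Finset.univ.image g.1 ∪ Finset.univ.image g.2).card) := by
        simp only [Fintype.sum_prod_type, vert, pow_add]
        rw [Finset.sum_mul_sum]
        apply Finset.sum_congr rfl; intro u _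
        apply Finset.sum_congr rfl; intro v _
        rw [Finset.sum_mul_sum]
    _ ≤ (p * (n + 1 : ℕ) + ((l + 1) + (l' + 1) : ℕ)) ^ ((l + 1) + (l' + 1)) *
        (p * (m + 1 : ℕ) + ((l + 1) + (l' + 1) : ℕ)) ^ ((l + 1) + (l' + 1)) := by
        apply mul_le_mul (sum_pow_image_two _ _ _ _ hp) (sum_pow_image_two _ _ _ _ hp)
        · exact Finset.sum_nonneg fun _ _ => by positivity
        · positivity
    _ ≤ _ := by
        have h1' : p * (n + 1 : ℕ) ≤ β := by push_cast; exact h1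
        have h2' : p * (m + 1 : ℕ) ≤ β := by push_cast; exact h2
        have hβ : 0 ≤ β := le_trans (by positivity) h1
        gcongr

noncomputable def KK (L : ℕ) (β : ℝ) : ℝ :=
  ∑ l ∈ Finset.range (L + 1), ∑ l' ∈ Finset.range (L + 1),
    (β + ((l + 1) + (l' + 1) : ℕ)) ^ ((l + 1) + (l' + 1)) * (β + ((l + 1) + (l' + 1) : ℕ)) ^ ((l + 1) + (l' + 1))

lemma KK_nonneg (L : ℕ) {β : ℝ} (hβ : 0 ≤ β) : 0 ≤ KK L β := by
  unfold KK
  exact Finset.sum_nonneg fun _ _ => Finset.sum_nonneg fun _ _ => by positivity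

lemma spair_sum_le (L : ℕ) (p β : ℝ) (hp : 0 ≤ p) (h1 : p * (n + 1) ≤ β) (h2 : p * (m + 1) ≤ β) :
    ∑ P ∈ spaths n m L, ∑ Q ∈ spaths n m L, p ^ vert P.2 Q.2 ≤ KK L β := by
  unfold KK spaths
  rw [Finset.sum_sigma]
  apply Finset.sum_le_sum
  intro l _
  simp_rw [Finset.sum_sigma]
  rw [Finset.sum_comm]
  apply Finset.sum_le_sum
  intro l' _
  exact pair_sum_le l l' p β hp h1 h2

lemma avg_W_le {t e : ℕ} (L : ℕ) (hte : t ≤ e) (he : e ≤ (n + 1) * (m + 1)) (β : ℝ)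
    (h1 : (e : ℝ) / (((n + 1) * (m + 1) : ℕ) : ℝ) * (n + 1) ≤ β)
    (h2 : (e : ℝ) / (((n + 1) * (m + 1) : ℕ) : ℝ) * (m + 1) ≤ β) :
    avg t (fun E : Finset (Cell n m) => (W L E : ℝ)) ≤ KK L β := by
  classical
  set p := (e : ℝ) / (((n + 1) * (m + 1) : ℕ) : ℝ) with hp
  have hp0 : 0 ≤ p := by positivity
  have hp1 : p ≤ 1 := by
    rw [hp]; apply div_le_one_of_le₀ _ (by positivity); exact_mod_cast he
  have hW : ∀ E : Finset (Cell n m), (W L E : ℝ) =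
      ∑ PQ ∈ (spaths n m L ×ˢ spaths n m L).filter (fun PQ => PQ.1 ≠ PQ.2 ∧ sends PQ.1 = sends PQ.2),
        if scells PQ.1 ∪ scells PQ.2 ⊆ E then (1:ℝ) else 0 := by
    intro E
    unfold W
    rw [Finset.card_eq_sum_ones, Nat.cast_sum, ← Finset.sum_filter, Finset.filter_filter]
    simp [and_assoc]
  simp_rw [hW]
  rw [avg_sum]
  calc _ ≤ ∑ PQ ∈ (spaths n m L ×ˢ spaths n m L).filter (fun PQ => PQ.1 ≠ PQ.2 ∧ sends PQ.1 = sends PQ.2),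
          p ^ vert PQ.1.2 PQ.2.2 := by
        apply Finset.sum_le_sum
        rintro ⟨P, Q⟩ hPQ
        simp only [Finset.mem_filter, Finset.mem_product, mem_spaths] at hPQ
        obtain ⟨⟨⟨-, hP⟩, -, hQ⟩, hne, hends⟩ := hPQ
        refine (prob_le hte he _).trans ?_
        apply pow_le_pow_of_le_one hp0 hp1
        have hz : 1 ≤ Z (scells P ∪ scells Q) := by
          apply Z_pos_of_not_acyclic
          intro hac
          exact hne (path_unique _ hac P Q hP hQ Finset.subset_union_left Finset.subset_union_right hends)
        have hr : P.2.1 0 = Q.2.1 0 := congrArg Prod.fst hends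
        have := vert_le P.2 Q.2 (by rw [hr])
        simp only [scells] at hz ⊢
        omega
    _ ≤ ∑ PQ ∈ spaths n m L ×ˢ spaths n m L, p ^ vert PQ.1.2 PQ.2.2 :=
        Finset.sum_le_sum_of_subset_of_nonneg (Finset.filter_subset _ _) (fun _ _ _ => by positivity)
    _ = ∑ P ∈ spaths n m L, ∑ Q ∈ spaths n m L, p ^ vert P.2 Q.2 := by
        rw [Finset.sum_product]
    _ ≤ _ := spair_sum_le L p β hp0 h1 h2

lemma Y_eq_sum (L : ℕ) (E : Finset (Cell n m)) : 
    (Y L E : ℝ) = ∑ P ∈ spaths n m L, (open Classical in if scells P ⊆ E then (1:ℝ) else 0) := by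
  classical
  unfold Y
  rw [Finset.card_eq_sum_ones, Nat.cast_sum, ← Finset.sum_filter]
  simp

lemma avg_Y {t : ℕ} (L : ℕ) (ht : t ≤ (n + 1) * (m + 1)) :
    avg t (fun E : Finset (Cell n m) => (Y L E : ℝ)) = ∑ l ∈ Finset.range (L + 1), EP n m l t := by
  simp_rw [Y_eq_sum]
  rw [avg_sum]
  unfold spaths
  rw [Finset.sum_sigma]
  apply Finset.sum_congr rfl
  intro l _
  have : ∀ π ∈ paths n m l, avg t (fun E => (open Classical in if scells (⟨l, π⟩ : SP n m) ⊆ E then (1:ℝ) else 0)) =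
      (t.descFactorial (2 * l + 1) : ℝ) / (((n + 1) * (m + 1)).descFactorial (2 * l + 1) : ℝ) := by
    intro π hπ
    rw [avg_ind ht]
    simp only [scells]
    rw [card_cells hπ]
  rw [Finset.sum_congr rfl this, Finset.sum_const, card_paths, nsmul_eq_mul]
  unfold EP
  push_cast
  ring

lemma sum_prob_le (L t : ℕ) :
    ∑ P ∈ spaths n m L, ((t : ℝ) / (((n + 1) * (m + 1) : ℕ) : ℝ)) ^ (scells P).card
      ≤ yy L ((n + 1) * (m + 1)) t := by
  unfold spaths yy
  rw [Finset.sum_sigma]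
  apply Finset.sum_le_sum
  intro l _
  have : ∀ π ∈ paths n m l, ((t : ℝ) / (((n + 1) * (m + 1) : ℕ) : ℝ)) ^ (scells (⟨l, π⟩ : SP n m)).card =
      ((t : ℝ) / (((n + 1) * (m + 1) : ℕ) : ℝ)) ^ (2 * l + 1) := by
    intro π hπ
    simp only [scells]
    rw [card_cells hπ]
  rw [Finset.sum_congr rfl this, Finset.sum_const, card_paths, nsmul_eq_mul]
  have hN : (0:ℝ) < (((n + 1) * (m + 1) : ℕ) : ℝ) := by positivity
  have h2 : (((n + 1).descFactorial (l + 1) * (m + 1).descFactorial (l + 1) : ℕ) : ℝ) ≤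
      (((n + 1) * (m + 1) : ℕ) : ℝ) ^ (l + 1) := by
    rw [← Nat.cast_pow, mul_pow]
    exact_mod_cast Nat.mul_le_mul (Nat.descFactorial_le_pow _ _) (Nat.descFactorial_le_pow _ _)
  refine (mul_le_mul_of_nonneg_right h2 (by positivity)).trans (le_of_eq ?_)
  generalize (((n + 1) * (m + 1) : ℕ) : ℝ) = N at *
  rw [div_pow, div_pow]
  field_simp
  ring

lemma avg_Y_sq_le {t e : ℕ} (L : ℕ) (hte : t ≤ e) (he0 : 0 < e) (he : e ≤ (n + 1) * (m + 1)) (β : ℝ)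
    (h1 : (e : ℝ) / (((n + 1) * (m + 1) : ℕ) : ℝ) * (n + 1) ≤ β)
    (h2 : (e : ℝ) / (((n + 1) * (m + 1) : ℕ) : ℝ) * (m + 1) ≤ β) :
    avg t (fun E : Finset (Cell n m) => (Y L E : ℝ) ^ 2) ≤
      yy L ((n + 1) * (m + 1)) t ^ 2 + (((n + 1) * (m + 1) : ℕ) : ℝ) / e * KK L β := by
  classical
  set N : ℕ := (n + 1) * (m + 1) with hN
  have hN0 : (0:ℝ) < N := by rw [hN]; positivity
  have he0' : (0:ℝ) < e := by exact_mod_cast he0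
  set p := (e : ℝ) / (N : ℝ) with hp
  have hp0 : 0 < p := by positivity
  have hp1 : p ≤ 1 := by
    rw [hp]; apply div_le_one_of_le₀ _ (by positivity); exact_mod_cast he
  set r := (t : ℝ) / (N : ℝ) with hr
  have hr0 : 0 ≤ r := by positivity
  have hY2 : ∀ E : Finset (Cell n m), (Y L E : ℝ) ^ 2 = ∑ P ∈ spaths n m L, ∑ Q ∈ spaths n m L,
      if scells P ∪ scells Q ⊆ E then (1:ℝ) else 0 := by
    intro E
    rw [Y_eq_sum, sq, Finset.sum_mul_sum]
    apply Finset.sum_congr rfl; intro P _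
    apply Finset.sum_congr rfl; intro Q _
    simp only [Finset.union_subset_iff]
    by_cases a : scells P ⊆ E <;> by_cases b : scells Q ⊆ E <;> simp [a, b]
  simp_rw [hY2]
  rw [avg_sum]
  simp_rw [avg_sum]
  calc _ ≤ ∑ P ∈ spaths n m L, ∑ Q ∈ spaths n m L,
          (r ^ (scells P).card * r ^ (scells Q).card + (N : ℝ) / e * p ^ vert P.2 Q.2) := by
        apply Finset.sum_le_sum; intro P hP
        apply Finset.sum_le_sum; intro Q hQ
        by_cases hd : Disjoint (scells P) (scells Q)
        · refine (prob_le le_rfl (hte.trans he) _).trans ?_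
          rw [Finset.card_union_of_disjoint hd, pow_add]
          have : 0 ≤ (N : ℝ) / e * p ^ vert P.2 Q.2 := by positivity
          linarith
        · refine (prob_le hte he _).trans ?_
          have hv := vert_le P.2 Q.2 (reach_of_not_disjoint _ _ hd)
          have h3 : p ^ ((scells P ∪ scells Q).card + 1) ≤ p ^ vert P.2 Q.2 := by
            apply pow_le_pow_of_le_one hp0.le hp1
            simp only [scells]
            omega
          have h4 : p ^ (scells P ∪ scells Q).card = (N : ℝ) / e * p ^ ((scells P ∪ scells Q).card + 1) := by
            rw [pow_succ, hp]; field_simp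
          have h5 : 0 ≤ r ^ (scells P).card * r ^ (scells Q).card := by positivity
          rw [← hN, ← hp, h4]
          have h6 : (N : ℝ) / e * p ^ ((scells P ∪ scells Q).card + 1) ≤ (N : ℝ) / e * p ^ vert P.2 Q.2 := by
            gcongr
          linarith
    _ = (∑ P ∈ spaths n m L, r ^ (scells P).card) ^ 2 + (N : ℝ) / e * ∑ P ∈ spaths n m L, ∑ Q ∈ spaths n m L, p ^ vert P.2 Q.2 := by
        rw [sq, Finset.sum_mul_sum, Finset.mul_sum, ← Finset.sum_add_distrib]
        apply Finset.sum_congr rfl; intro P _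
        rw [Finset.sum_add_distrib, Finset.mul_sum]
    _ ≤ _ := by
        gcongr
        · exact sum_prob_le L t
        · exact spair_sum_le L p β hp0.le h1 h2

lemma yy_nonneg (L N t : ℕ) : 0 ≤ yy L N t := Finset.sum_nonneg fun _ _ => by positivity

lemma yy_le (L : ℕ) {N t : ℕ} (h : (t : ℝ) ^ 2 ≤ N) : yy L N t ≤ (L + 1) * t := by
  unfold yy
  calc _ ≤ ∑ l ∈ Finset.range (L + 1), (t : ℝ) := by
        apply Finset.sum_le_sum
        intro l _
        have : ((t : ℝ) ^ 2 / N) ^ l ≤ 1 := pow_le_one₀ (by positivity) (div_le_one_of_le₀ h (by positivity))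
        have h0 : (0:ℝ) ≤ t := by positivity
        nlinarith
    _ = _ := by simp

theorem avg_bound (L : ℕ) (β c1 : ℝ) (hβ : 0 ≤ β) (hc0 : 0 ≤ c1) (hc1 : c1 < 1) :
    ∃ K : ℝ, 0 ≤ K ∧ ∀ n m e t : ℕ, 0 < e → e ≤ (n + 1) * (m + 1) → L ≤ n → t ≤ e →
      (e : ℝ) ≤ β * (n + 1) → (e : ℝ) ≤ β * (m + 1) →
      (e : ℝ) ^ 2 ≤ c1 * (((n + 1) * (m + 1) : ℕ) : ℝ) →
      avg t (fun E : Finset (Cell n m) => |(S E : ℝ) - yy L ((n + 1) * (m + 1)) t|) ≤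
        e * (c1 ^ (L + 1) / (1 - c1)) + K + √(K * ((((n + 1) * (m + 1) : ℕ) : ℝ) / e + e)) := by
  set K1 : ℝ := ∑ l ∈ Finset.range (L + 1), (2 * (l:ℝ) + 1) ^ 2 * (2 * β + 1) with hK1
  have hK10 : 0 ≤ K1 := Finset.sum_nonneg fun _ _ => by positivity
  have hKK := KK_nonneg L hβ
  refine ⟨KK L β + 2 * (L + 1) * K1, by positivity, ?_⟩
  intro n m e t he0 heN hLn hte hn hm hc
  set N : ℕ := (n + 1) * (m + 1) with hN
  have hN0 : (0:ℝ) < N := by rw [hN]; positivity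
  have he0' : (0:ℝ) < e := by exact_mod_cast he0
  have htN : t ≤ N := hte.trans heN
  have hteR : (t:ℝ) ≤ e := by exact_mod_cast hte
  have ht0 : (0:ℝ) ≤ t := by positivity
  have ht2 : (t:ℝ)^2 ≤ c1 * N := le_trans (by gcongr) hc
  have ht2' : (t:ℝ)^2 ≤ N := by nlinarith
  have hNR : (N:ℝ) = ((n:ℝ) + 1) * (m + 1) := by rw [hN]; push_cast; ring
  have b1 : (e : ℝ) / (N : ℝ) * (n + 1) ≤ β := by
    rw [hNR, div_mul_eq_mul_div, div_le_iff₀ (by positivity)]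
    have : (0:ℝ) ≤ n + 1 := by positivity
    nlinarith
  have b2 : (e : ℝ) / (N : ℝ) * (m + 1) ≤ β := by
    rw [hNR, div_mul_eq_mul_div, div_le_iff₀ (by positivity)]
    have : (0:ℝ) ≤ m + 1 := by positivity
    nlinarith
  set y := yy L N t with hy
  have hy0 : 0 ≤ y := yy_nonneg _ _ _
  have hyL : y ≤ (L + 1) * e := (yy_le L ht2').trans (by gcongr)
  -- pointwise
  have hpt : avg t (fun E : Finset (Cell n m) => |(S E : ℝ) - y|) ≤
      avg t (fun E : Finset (Cell n m) => (Y n E : ℝ)) - avg t (fun E : Finset (Cell n m) => (Y L E : ℝ))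
      + avg t (fun E : Finset (Cell n m) => (W L E : ℝ))
      + avg t (fun E : Finset (Cell n m) => |(Y L E : ℝ) - y|) := by
    rw [← avg_sub, ← avg_add, ← avg_add]
    apply avg_mono
    intro E _
    have a1 : (S E : ℝ) ≤ Y n E := by exact_mod_cast S_le_Y E
    have a2 : (Y L E : ℝ) ≤ S E + W L E := by exact_mod_cast Y_le_S_add_W L E
    have a3 : (Y L E : ℝ) ≤ Y n E := by exact_mod_cast Y_mono_sub L hLn E
    have a4 := le_abs_self ((Y L E : ℝ) - y)
    have a5 := neg_abs_le ((Y L E : ℝ) - y)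
    have a6 : (0:ℝ) ≤ W L E := by positivity
    rw [abs_le]
    constructor <;> linarith
  have hW := avg_W_le (n := n) (m := m) L hte heN β b1 b2
  have hdiff : avg t (fun E : Finset (Cell n m) => (Y n E : ℝ)) - avg t (fun E : Finset (Cell n m) => (Y L E : ℝ))
      ≤ e * (c1 ^ (L + 1) / (1 - c1)) := by
    rw [avg_Y _ htN, avg_Y _ htN, Finset.range_eq_Ico,
      ← Finset.sum_Ico_consecutive _ (Nat.zero_le (L + 1)) (by omega : L + 1 ≤ n + 1), ← Finset.range_eq_Ico]
    rw [add_sub_cancel_left]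
    calc _ ≤ ∑ l ∈ Finset.Ico (L + 1) (n + 1), (e:ℝ) * c1 ^ l := by
          apply Finset.sum_le_sum
          intro l _
          refine (EP_le htN).trans ?_
          gcongr
          rw [div_le_iff₀ hN0]; exact ht2
      _ = e * ∑ l ∈ Finset.Ico (L + 1) (n + 1), c1 ^ l := by rw [Finset.mul_sum]
      _ ≤ _ := by
          gcongr
          exact geom_sum_Ico_le_of_lt_one hc0 hc1
  have hYlow : y - K1 ≤ avg t (fun E : Finset (Cell n m) => (Y L E : ℝ)) := by
    rw [avg_Y _ htN, hy, hK1, yy, ← Finset.sum_sub_distrib]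
    apply Finset.sum_le_sum
    intro l _
    exact EP_ge htN ht2' β (hteR.trans hn) (hteR.trans hm)
  have hsq := avg_Y_sq_le (n := n) (m := m) L hte he0 heN β b1 b2
  have hvar : avg t (fun E : Finset (Cell n m) => ((Y L E : ℝ) - y) ^ 2) ≤
      (KK L β + 2 * (L + 1) * K1) * ((N : ℝ) / e + e) := by
    have : avg t (fun E : Finset (Cell n m) => ((Y L E : ℝ) - y) ^ 2) =
        avg t (fun E : Finset (Cell n m) => (Y L E : ℝ) ^ 2) - 2 * y * avg t (fun E : Finset (Cell n m) => (Y L E : ℝ)) + y ^ 2 := by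
      have h3 : avg (n := n) (m := m) t (fun _ => y ^ 2) = y ^ 2 := avg_const htN _
      rw [← avg_mul, ← avg_sub]
      have h4 := avg_add t (fun E : Finset (Cell n m) => (Y L E : ℝ) ^ 2 - 2 * y * (Y L E : ℝ)) (fun _ => y ^ 2)
      rw [h3] at h4
      rw [← h4]
      apply avg_congr
      intro E _
      ring
    rw [this]
    have q1 : 2 * y * (y - K1) ≤ 2 * y * avg t (fun E : Finset (Cell n m) => (Y L E : ℝ)) := by gcongr
    have q2 : y * K1 ≤ (L + 1) * e * K1 := by gcongr
    have q3 : 0 ≤ KK L β * e := by positivity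
    have q4 : 0 ≤ 2 * (L + 1) * K1 * ((N : ℝ) / e) := by positivity
    rw [← hN] at hsq
    rw [← hy] at hsq
    nlinarith
  have hsd := (avg_abs_le_sqrt htN (fun E : Finset (Cell n m) => (Y L E : ℝ) - y)).trans (Real.sqrt_le_sqrt hvar)
  have : 0 ≤ 2 * (L + 1) * K1 := by positivity
  linarith

end Kal


namespace Kal
variable {n m : ℕ}

noncomputable def pp (j : ℕ) (x : ℝ) : ℝ := x ^ j * Real.exp (-x) / (Nat.factorial j : ℝ)

noncomputable def pm : ℕ → ℝ → ℝ
  | 0, _ => 0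
  | j + 1, x => pp j x

lemma pp_deriv (j : ℕ) (x : ℝ) : HasDerivAt (pp j) (pm j x - pp j x) x := by
  have h1 : HasDerivAt (fun y : ℝ => Real.exp (-y)) (Real.exp (-x) * (-1)) x :=
    (Real.hasDerivAt_exp (-x)).comp x (hasDerivAt_neg x)
  have h2 := ((hasDerivAt_pow j x).mul h1).div_const (Nat.factorial j : ℝ)
  suffices h3 : pm j x - pp j x = (↑j * x ^ (j - 1) * Real.exp (-x) + x ^ j * (Real.exp (-x) * -1)) / (Nat.factorial j : ℝ) by
    rw [h3]; exact h2
  cases j with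
  | zero => simp [pm, pp]
  | succ j =>
    have : ((Nat.factorial j : ℕ) : ℝ) ≠ 0 := by positivity
    simp only [pm, pp, Nat.factorial_succ]
    push_cast
    have : ((j:ℝ) + 1) ≠ 0 := by positivity
    field_simp
    ring

lemma pp_nonneg (j : ℕ) {x : ℝ} (hx : 0 ≤ x) : 0 ≤ pp j x := by unfold pp; positivity

lemma pp_le_one (j : ℕ) {x : ℝ} (hx : 0 ≤ x) : pp j x ≤ 1 := by
  have h := Real.pow_div_factorial_le_exp x hx j
  unfold pp
  rw [Real.exp_neg, mul_div_right_comm, ← div_eq_mul_inv]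
  exact div_le_one_of_le₀ h (Real.exp_pos x).le

lemma pm_nonneg (j : ℕ) {x : ℝ} (hx : 0 ≤ x) : 0 ≤ pm j x := by
  cases j with
  | zero => simp [pm]
  | succ j => exact pp_nonneg j hx

lemma pm_le_one (j : ℕ) {x : ℝ} (hx : 0 ≤ x) : pm j x ≤ 1 := by
  cases j with
  | zero => simp [pm]
  | succ j => exact pp_le_one j hx

lemma pp_lip (j : ℕ) {x y : ℝ} (hx : 0 ≤ x) (hy : 0 ≤ y) : |pp j y - pp j x| ≤ |y - x| := by
  have := Convex.norm_image_sub_le_of_norm_hasDerivWithin_le (f := pp j) (C := 1) (s := Set.Ici (0:ℝ))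
    (f' := fun x => pm j x - pp j x) (fun z _ => (pp_deriv j z).hasDerivWithinAt)
    (fun z hz => by
      have hz : 0 ≤ z := hz
      have a1 := pp_nonneg j hz
      have a2 := pp_le_one j hz
      have a3 := pm_nonneg j hz
      have a4 := pm_le_one j hz
      rw [Real.norm_eq_abs, abs_le]; constructor <;> linarith) (convex_Ici 0) hx hy
  simpa using this

lemma pm_lip (j : ℕ) {x y : ℝ} (hx : 0 ≤ x) (hy : 0 ≤ y) : |pm j y - pm j x| ≤ |y - x| := by
  cases j with
  | zero => simp [pm]
  | succ j => exact pp_lip j hx hy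

lemma pp_step (j : ℕ) {x q : ℝ} (hx : 0 ≤ x) (hq : 0 ≤ q) :
    |pp j (x + q) - (q * pm j x + (1 - q) * pp j x)| ≤ 2 * q ^ 2 := by
  set D := pm j x - pp j x with hD
  have := Convex.norm_image_sub_le_of_norm_hasDerivWithin_le (f := fun s => pp j s - s * D)
    (C := 2 * q) (s := Set.Icc x (x + q))
    (f' := fun s => (pm j s - pp j s) - 1 * D)
    (fun z _ => ((pp_deriv j z).sub ((hasDerivAt_id z).mul_const D)).hasDerivWithinAt)
    (fun z hz => by
      have hz0 : 0 ≤ z := hx.trans hz.1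
      have a1 := pp_lip j hx hz0
      have a2 := pm_lip j hx hz0
      have a3 : |z - x| ≤ q := by rw [abs_le]; constructor <;> linarith [hz.1, hz.2]
      have b1 := abs_le.1 (a1.trans a3)
      have b2 := abs_le.1 (a2.trans a3)
      rw [Real.norm_eq_abs, abs_le, hD]; constructor <;> linarith [b1.1, b1.2, b2.1, b2.2])
    (convex_Icc _ _) (x := x) (y := x + q) ⟨le_rfl, by linarith⟩ ⟨by linarith, le_rfl⟩
  rw [Real.norm_eq_abs, Real.norm_eq_abs] at this
  have e1 : pp j (x + q) - (x + q) * D - (pp j x - x * D) = pp j (x + q) - (q * pm j x + (1 - q) * pp j x) := by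
    rw [hD]; ring
  have e2 : 2 * q * |x + q - x| = 2 * q ^ 2 := by
    rw [add_sub_cancel_left, abs_of_nonneg hq]; ring
  rw [e1, e2] at this
  exact this

def shift (f : ℕ → ℝ) : ℕ → ℝ
  | 0 => 0
  | j + 1 => f j

lemma recursion (P : ℕ → ℕ → ℝ) (q δ : ℕ → ℝ) (T : ℕ)
    (hq0 : ∀ s < T, 0 ≤ q s) (hq1 : ∀ s < T, q s ≤ 1)
    (h0 : ∀ j, P 0 j = pp j 0)
    (hstep : ∀ s < T, ∀ j, |P (s + 1) j - (q s * shift (P s) j + (1 - q s) * P s j)| ≤ δ s) :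
    ∀ t ≤ T, ∀ j, |P t j - pp j (∑ s ∈ Finset.range t, q s)| ≤
      ∑ s ∈ Finset.range t, (δ s + 2 * q s ^ 2) := by
  intro t
  induction t with
  | zero => intro _ j; simp [h0]
  | succ t ih =>
    intro ht j
    have ih := ih (by omega)
    have htT : t < T := by omega
    rw [Finset.sum_range_succ, Finset.sum_range_succ]
    set x := ∑ s ∈ Finset.range t, q s with hx
    set B := ∑ s ∈ Finset.range t, (δ s + 2 * q s ^ 2) with hB
    have hx0 : 0 ≤ x := Finset.sum_nonneg fun s hs => hq0 s (by simp at hs; omega)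
    have hB0 : 0 ≤ B := (abs_nonneg _).trans (ih 0)
    have h1 := abs_le.1 (hstep t htT j)
    have h2 := abs_le.1 (pp_step j hx0 (hq0 t htT))
    have h3 := abs_le.1 (ih j)
    have h4 : |shift (P t) j - pm j x| ≤ B := by
      cases j with
      | zero => simpa [shift, pm] using hB0
      | succ j => exact ih j
    have h4 := abs_le.1 h4
    have q0 := hq0 t htT
    have q1 := hq1 t htT
    have m1 := mul_le_mul_of_nonneg_left h4.1 q0
    have m2 := mul_le_mul_of_nonneg_left h4.2 q0
    have m3 := mul_le_mul_of_nonneg_left h3.1 (sub_nonneg.2 q1)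
    have m4 := mul_le_mul_of_nonneg_left h3.2 (sub_nonneg.2 q1)
    rw [abs_le]
    constructor <;> linarith [h1.1, h1.2, h2.1, h2.2]

lemma double_count (t : ℕ) (g : Finset (Cell n m) → ℝ) :
    ((t : ℝ) + 1) * ∑ E ∈ Finset.powersetCard (t + 1) (Finset.univ : Finset (Cell n m)), g E =
    ∑ E ∈ Finset.powersetCard t (Finset.univ : Finset (Cell n m)), ∑ x ∈ Eᶜ, g (insert x E) := by
  have h1 : ((t : ℝ) + 1) * ∑ E ∈ Finset.powersetCard (t + 1) (Finset.univ : Finset (Cell n m)), g E =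
      ∑ E ∈ Finset.powersetCard (t + 1) (Finset.univ : Finset (Cell n m)), ∑ x ∈ E, g E := by
    rw [Finset.mul_sum]
    apply Finset.sum_congr rfl
    intro E hE
    rw [Finset.sum_const, (Finset.mem_powersetCard.1 hE).2]
    simp
  rw [h1, Finset.sum_sigma', Finset.sum_sigma']
  refine Finset.sum_bij' (fun a _ => ⟨a.1.erase a.2, a.2⟩) (fun a _ => ⟨insert a.2 a.1, a.2⟩) ?_ ?_ ?_ ?_ ?_
  · rintro ⟨E, x⟩ h
    simp only [Finset.mem_sigma, Finset.mem_powersetCard, Finset.subset_univ, true_and] at h ⊢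
    rw [Finset.card_erase_of_mem h.2, h.1]
    simp
  · rintro ⟨E, x⟩ h
    simp only [Finset.mem_sigma, Finset.mem_powersetCard, Finset.subset_univ, true_and, Finset.mem_compl] at h ⊢
    rw [Finset.card_insert_of_notMem h.2, h.1]
    simp
  · rintro ⟨E, x⟩ h
    simp only [Finset.mem_sigma] at h
    simp [Finset.insert_erase h.2]
  · rintro ⟨E, x⟩ h
    simp only [Finset.mem_sigma, Finset.mem_compl] at h
    simp [Finset.erase_insert h.2]
  · rintro ⟨E, x⟩ h
    simp only [Finset.mem_sigma] at h
    simp [Finset.insert_erase h.2]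

lemma avg_succ {t : ℕ} (ht : t < (n + 1) * (m + 1)) (g : Finset (Cell n m) → ℝ) :
    avg (t + 1) g = avg t (fun E => (∑ x ∈ Eᶜ, g (insert x E)) / ((((n + 1) * (m + 1) : ℕ) : ℝ) - t)) := by
  unfold avg
  rw [← Finset.sum_div, ← double_count]
  set N := (n + 1) * (m + 1)
  have h1 : (N.choose (t + 1) : ℝ) * (t + 1) = N.choose t * ((N : ℝ) - t) := by
    have := Nat.choose_succ_right_eq N t
    have h2 : ((N - t : ℕ) : ℝ) = (N : ℝ) - t := by rw [Nat.cast_sub ht.le]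
    rw [← h2]
    exact_mod_cast this
  have p1 : (0:ℝ) < (N.choose (t + 1) : ℝ) := by exact_mod_cast Nat.choose_pos ht
  have p2 : (0:ℝ) < (N.choose t : ℝ) := by exact_mod_cast Nat.choose_pos ht.le
  have p3 : (0:ℝ) < (N:ℝ) - t := by
    have : (t:ℝ) < N := by exact_mod_cast ht
    linarith
  rw [div_div, div_eq_div_iff p1.ne' (by positivity)]
  linear_combination -(∑ E ∈ Finset.powersetCard (t + 1) (Finset.univ : Finset (Cell n m)), g E) * h1

noncomputable def ind (j : ℕ) (E : Finset (Cell n m)) : ℝ := if Z E = j then 1 else 0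

lemma ind_shift (E : Finset (Cell n m)) (j : ℕ) :
    (if Z E + 1 = j then (1:ℝ) else 0) = shift (fun i => ind i E) j := by
  cases j with
  | zero => simp [shift]
  | succ j => simp [shift, ind]

lemma sum_ind (E : Finset (Cell n m)) (j : ℕ) :
    ∑ x ∈ Eᶜ, ind j (insert x E) = ((S E : ℝ) - E.card) * shift (fun i => ind i E) j
      + ((((n + 1) * (m + 1) : ℕ) : ℝ) - S E) * ind j E := by
  classical
  have hx : ∀ x ∈ Eᶜ, ind j (insert x E) = if Conn E x then shift (fun i => ind i E) j else ind j E := by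
    intro x hx
    rw [Finset.mem_compl] at hx
    split_ifs with h
    · rw [← ind_shift, ind, Z_insert_conn hx h]
    · rw [ind, Z_insert_not_conn hx h, ind]
  rw [Finset.sum_congr rfl hx, Finset.sum_ite, Finset.sum_const, Finset.sum_const, nsmul_eq_mul, nsmul_eq_mul]
  have c1 : (Eᶜ.filter fun x => Conn E x).card + E.card = S E := by
    have : S E = (Finset.univ.filter fun x => Conn E x).card := by unfold S; congr
    rw [this, ← Finset.card_union_of_disjoint]
    · congr 1
      ext x
      simp only [Finset.mem_union, Finset.mem_filter, Finset.mem_compl, Finset.mem_univ, true_and]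
      have := @conn_of_mem n m E x
      tauto
    · rw [Finset.disjoint_left]
      intro x hx
      simp at hx
      exact hx.1
  have c2 : (Eᶜ.filter fun x => Conn E x).card + (Eᶜ.filter fun x => ¬ Conn E x).card + E.card = (n + 1) * (m + 1) := by
    rw [Finset.card_filter_add_card_filter_not, Finset.card_compl, card_cell, Nat.sub_add_cancel]
    rw [← card_cell]; exact Finset.card_le_univ E
  have d1 : ((Eᶜ.filter fun x => Conn E x).card : ℝ) = S E - E.card := by
    rw [← c1]; push_cast; ring
  have d2 : ((Eᶜ.filter fun x => ¬ Conn E x).card : ℝ) = (((n + 1) * (m + 1) : ℕ) : ℝ) - S E := by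
    rw [← c1, ← c2]; push_cast; ring
  rw [d1, d2]

lemma shift_avg (t j : ℕ) : shift (fun i => avg t (fun E : Finset (Cell n m) => ind i E)) j =
    avg t (fun E : Finset (Cell n m) => shift (fun i => ind i E) j) := by
  cases j with
  | zero => simp [shift, avg]
  | succ j => simp [shift]

lemma avg_step {t : ℕ} (ht : t < (n + 1) * (m + 1)) (y : ℝ) (j : ℕ) :
    |avg (t + 1) (fun E : Finset (Cell n m) => ind j E) -
      ((y - t) / ((((n + 1) * (m + 1) : ℕ) : ℝ) - t) * shift (fun i => avg t (fun E : Finset (Cell n m) => ind i E)) j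
        + (1 - (y - t) / ((((n + 1) * (m + 1) : ℕ) : ℝ) - t)) * avg t (fun E : Finset (Cell n m) => ind j E))| ≤
      avg t (fun E : Finset (Cell n m) => |(S E : ℝ) - y|) / ((((n + 1) * (m + 1) : ℕ) : ℝ) - t) := by
  rw [avg_succ ht, shift_avg, ← avg_mul, ← avg_mul, ← avg_add, ← avg_sub]
  refine (abs_avg_le _ _).trans ?_
  rw [div_eq_inv_mul (avg t (fun E : Finset (Cell n m) => |(S E : ℝ) - y|)), ← avg_mul]
  apply avg_mono
  intro E hE
  rw [sum_ind, hE]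
  have p3 : (0:ℝ) < (((n + 1) * (m + 1) : ℕ) : ℝ) - t := by
    have : (t:ℝ) < (((n + 1) * (m + 1) : ℕ) : ℝ) := by exact_mod_cast ht
    linarith
  set M := (((n + 1) * (m + 1) : ℕ) : ℝ)
  set u := shift (fun i => ind i E) j with hu
  set v := ind j E with hv
  have e1 : ((S E : ℝ) - t) * u + (M - S E) * v = (M - t) * v + ((S E : ℝ) - t) * (u - v) := by ring
  have e2 : ((S E - t) * u + (M - S E) * v) / (M - t) - ((y - t) / (M - t) * u + (1 - (y - t) / (M - t)) * v)
      = (M - t)⁻¹ * ((S E - y) * (u - v)) := by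
    field_simp
    ring
  rw [e2, abs_mul, abs_mul, abs_of_pos (inv_pos.2 p3)]
  have huv : |u - v| ≤ 1 := by
    rw [hu, hv, ← ind_shift, ind]
    split_ifs <;> simp
  have : |(S E : ℝ) - y| * |u - v| ≤ |(S E : ℝ) - y| := mul_le_of_le_one_right (abs_nonneg _) huv
  have := inv_pos.2 p3
  gcongr

lemma avg_ind_zero (j : ℕ) : avg 0 (fun E : Finset (Cell n m) => ind j E) = pp j 0 := by
  unfold avg ind pp
  rw [Finset.powersetCard_zero, Finset.sum_singleton, Z_empty]
  cases j with
  | zero => simp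
  | succ j => simp

/-- Combined bound. -/
lemma main_bound (T j L : ℕ) (hT : T ≤ (n + 1) * (m + 1))
    (hq0 : ∀ s < T, 0 ≤ (yy L ((n + 1) * (m + 1)) s - s) / ((((n + 1) * (m + 1) : ℕ) : ℝ) - s))
    (hq1 : ∀ s < T, (yy L ((n + 1) * (m + 1)) s - s) / ((((n + 1) * (m + 1) : ℕ) : ℝ) - s) ≤ 1) :
    |avg T (fun E : Finset (Cell n m) => ind j E) -
      pp j (∑ s ∈ Finset.range T, (yy L ((n + 1) * (m + 1)) s - s) / ((((n + 1) * (m + 1) : ℕ) : ℝ) - s))| ≤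
    ∑ s ∈ Finset.range T, (avg s (fun E : Finset (Cell n m) => |(S E : ℝ) - yy L ((n + 1) * (m + 1)) s|)
        / ((((n + 1) * (m + 1) : ℕ) : ℝ) - s)
      + 2 * ((yy L ((n + 1) * (m + 1)) s - s) / ((((n + 1) * (m + 1) : ℕ) : ℝ) - s)) ^ 2) :=
  recursion (fun t j => avg t (fun E : Finset (Cell n m) => ind j E)) _ _ T hq0 hq1 (fun j => avg_ind_zero j)
    (fun s hs j => avg_step (by omega) _ j) T le_rfl j

lemma ncard_eq (e j : ℕ) :
    (({E : Finset (Fin (n + 1) × Fin (m + 1)) |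
            E.card = e ∧ (Ncc n m E : ℤ) = n + m + 2 - e + j}.ncard : ℝ)) /
          (Nat.choose ((n + 1) * (m + 1)) e : ℝ) = avg e (fun E : Finset (Cell n m) => ind j E) := by
  classical
  unfold avg ind
  congr 1
  rw [← Finset.sum_filter, Finset.sum_const, nsmul_eq_mul, mul_one, ← Set.ncard_coe_finset]
  congr 2
  ext E
  simp only [Set.mem_ofPred_eq, Finset.coe_filter, Finset.mem_powersetCard, Finset.subset_univ, true_and]
  have := Z_spec E
  constructor
  · rintro ⟨h1, h2⟩
    refine ⟨h1, ?_⟩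
    omega
  · rintro ⟨h1, h2⟩
    refine ⟨h1, ?_⟩
    omega

end Kal


namespace Kal

lemma pow_diff (p : ℕ) (s : ℝ) (hs : 0 ≤ s) :
    ((p:ℝ) + 1) * s ^ p ≤ (s + 1) ^ (p + 1) - s ^ (p + 1) ∧
    (s + 1) ^ (p + 1) - s ^ (p + 1) ≤ ((p:ℝ) + 1) * (s + 1) ^ p := by
  have h := geom_sum₂_mul (s + 1) s (p + 1)
  rw [add_sub_cancel_left, mul_one] at h
  rw [← h]
  constructor
  · have : ∑ i ∈ Finset.range (p + 1), s ^ p = ((p:ℝ) + 1) * s ^ p := by simp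
    rw [← this]
    apply Finset.sum_le_sum
    intro i hi
    have hi : i ≤ p := by simp at hi; omega
    have : s ^ p = s ^ i * s ^ (p + 1 - 1 - i) := by rw [← pow_add]; congr 1; omega
    rw [this]
    gcongr
    linarith
  · have : ∑ i ∈ Finset.range (p + 1), (s + 1) ^ p = ((p:ℝ) + 1) * (s + 1) ^ p := by simp
    rw [← this]
    apply Finset.sum_le_sum
    intro i hi
    have hi : i ≤ p := by simp at hi; omega
    have : (s + 1) ^ p = (s + 1) ^ i * (s + 1) ^ (p + 1 - 1 - i) := by rw [← pow_add]; congr 1; omega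
    rw [this]
    gcongr
    linarith

lemma sum_pow_bounds (p e : ℕ) (hp : 0 < p) :
    ((p:ℝ) + 1) * ∑ s ∈ Finset.range e, (s:ℝ) ^ p ≤ (e:ℝ) ^ (p + 1) ∧
    (e:ℝ) ^ (p + 1) ≤ ((p:ℝ) + 1) * (∑ s ∈ Finset.range e, (s:ℝ) ^ p + (e:ℝ) ^ p) := by
  constructor
  · have := Finset.sum_range_sub (fun i : ℕ => (i:ℝ) ^ (p + 1)) e
    simp only [Nat.cast_zero, ne_eq, Nat.succ_ne_zero, not_false_eq_true, zero_pow, sub_zero] at this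
    rw [← this, Finset.mul_sum]
    apply Finset.sum_le_sum
    intro s _
    push_cast
    exact (pow_diff p s (by positivity)).1
  · have := Finset.sum_range_sub (fun i : ℕ => (i:ℝ) ^ (p + 1)) e
    simp only [Nat.cast_zero, ne_eq, Nat.succ_ne_zero, not_false_eq_true, zero_pow, sub_zero] at this
    rw [← this, ← Finset.sum_range_succ, Finset.sum_range_succ', Nat.cast_zero, zero_pow hp.ne', add_zero, Finset.mul_sum]
    apply Finset.sum_le_sum
    intro s _
    push_cast
    exact (pow_diff p s (by positivity)).2

lemma sum_pow_tendsto (p : ℕ) (hp : 0 < p) (e : ℕ → ℕ) (he : Tendsto e atTop atTop) :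
    Tendsto (fun k => (∑ s ∈ Finset.range (e k), (s:ℝ) ^ p) / (e k : ℝ) ^ (p + 1)) atTop (𝓝 (1 / ((p:ℝ) + 1))) := by
  have heR : Tendsto (fun k => (e k : ℝ)) atTop atTop := tendsto_natCast_atTop_atTop.comp he
  have hinv : Tendsto (fun k => ((e k : ℝ))⁻¹) atTop (𝓝 0) := tendsto_inv_atTop_zero.comp heR
  have hlow : Tendsto (fun k => 1 / ((p:ℝ) + 1) - ((e k : ℝ))⁻¹) atTop (𝓝 (1 / ((p:ℝ) + 1))) := by
    simpa using tendsto_const_nhds.sub hinv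
  refine tendsto_of_tendsto_of_tendsto_of_le_of_le' hlow tendsto_const_nhds ?_ ?_
  · filter_upwards [he.eventually_gt_atTop 0] with k hk
    have hk' : (0:ℝ) < e k := by exact_mod_cast hk
    have := (sum_pow_bounds p (e k) hp).2
    rw [le_div_iff₀ (by positivity)]
    have e1 : (1 / ((p:ℝ) + 1) - ((e k : ℝ))⁻¹) * (e k : ℝ) ^ (p + 1) = (e k : ℝ) ^ (p + 1) / (p + 1) - (e k : ℝ) ^ p := by
      field_simp
      ring
    rw [e1, sub_le_iff_le_add, div_le_iff₀ (by positivity)]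
    linarith
  · filter_upwards [he.eventually_gt_atTop 0] with k hk
    have hk' : (0:ℝ) < e k := by exact_mod_cast hk
    have := (sum_pow_bounds p (e k) hp).1
    rw [div_le_div_iff₀ (by positivity) (by positivity)]
    linarith

noncomputable def lamL (c : ℝ) (L : ℕ) : ℝ := ∑ l ∈ Finset.range L, c ^ (l + 2) / (2 * (l:ℝ) + 4)

lemma lamL_tendsto {c : ℝ} (hc0 : 0 < c) (hc1 : c < 1) :
    Tendsto (lamL c) atTop (𝓝 (-(Real.log (1 - c) + c) / 2)) := by
  have h := (Real.hasSum_pow_div_log_of_abs_lt_one (x := c) (by rw [abs_of_pos hc0]; exact hc1)).tendsto_sum_nat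
  have h1 := (tendsto_add_atTop_iff_nat 1).2 h
  have h2 := (h1.sub_const c).div_const 2
  convert h2 using 1
  · ext L
    rw [Finset.sum_range_succ', lamL]
    simp only [Nat.cast_add, Nat.cast_one, CharP.cast_eq_zero, zero_add, pow_one, div_one, add_sub_cancel_right]
    rw [Finset.sum_div]
    apply Finset.sum_congr rfl
    intro l _
    rw [div_div]
    congr 1
    ring
  · congr 1; ring

lemma lamL_nonneg {c : ℝ} (hc0 : 0 < c) (L : ℕ) : 0 ≤ lamL c L :=
  Finset.sum_nonneg fun _ _ => by positivity

lemma yy_sub (L N t : ℕ) : yy L N t - t = ∑ l ∈ Finset.range L, (t:ℝ) ^ (2 * l + 3) / (N:ℝ) ^ (l + 1) := by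
  unfold yy
  rw [Finset.sum_range_succ']
  simp only [pow_zero, mul_one, add_sub_cancel_right]
  apply Finset.sum_congr rfl
  intro l _
  rw [div_pow, ← pow_mul]
  ring

section asym
variable (e : ℕ → ℕ) (N : ℕ → ℕ) (c : ℝ)

lemma asym_eN (he : Tendsto e atTop atTop)
    (hcrit : Tendsto (fun k => (e k : ℝ) ^ 2 / (N k : ℝ)) atTop (𝓝 c)) :
    Tendsto (fun k => (e k : ℝ) / (N k : ℝ)) atTop (𝓝 0) := by
  have heR : Tendsto (fun k => (e k : ℝ)) atTop atTop := tendsto_natCast_atTop_atTop.comp he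
  have := hcrit.div_atTop heR
  refine this.congr' ?_
  filter_upwards [he.eventually_gt_atTop 0] with k hk
  have hk' : (0:ℝ) < e k := by exact_mod_cast hk
  field_simp

lemma asym_ratio (he : Tendsto e atTop atTop) (hN : ∀ k, 0 < N k)
    (hcrit : Tendsto (fun k => (e k : ℝ) ^ 2 / (N k : ℝ)) atTop (𝓝 c)) :
    Tendsto (fun k => (N k : ℝ) / ((N k : ℝ) - e k)) atTop (𝓝 1) := by
  have h := (tendsto_const_nhds (x := (1:ℝ))).sub (asym_eN e N c he hcrit)
  have h2 := h.inv₀ (by norm_num)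
  simp only [sub_zero, inv_one] at h2
  refine h2.congr ?_
  intro k
  have hk' : (0:ℝ) < N k := by exact_mod_cast hN k
  rw [← inv_div]
  congr 1
  field_simp

lemma asym_lt (he : Tendsto e atTop atTop) (hN : ∀ k, 0 < N k)
    (hcrit : Tendsto (fun k => (e k : ℝ) ^ 2 / (N k : ℝ)) atTop (𝓝 c)) :
    ∀ᶠ k in atTop, (e k : ℝ) < N k := by
  filter_upwards [(asym_eN e N c he hcrit).eventually (gt_mem_nhds (zero_lt_one))] with k hk
  have hk' : (0:ℝ) < N k := by exact_mod_cast hN k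
  rwa [div_lt_one hk'] at hk

lemma asym_sq (he : Tendsto e atTop atTop) (hN : ∀ k, 0 < N k)
    (hcrit : Tendsto (fun k => (e k : ℝ) ^ 2 / (N k : ℝ)) atTop (𝓝 c)) :
    Tendsto (fun k => (e k : ℝ) ^ 2 / ((N k : ℝ) - e k)) atTop (𝓝 c) := by
  have h := hcrit.mul (asym_ratio e N c he hN hcrit)
  rw [mul_one] at h
  refine h.congr ?_
  intro k
  have hk' : (0:ℝ) < N k := by exact_mod_cast hN k
  field_simp

lemma asym_lin (he : Tendsto e atTop atTop) (hN : ∀ k, 0 < N k)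
    (hcrit : Tendsto (fun k => (e k : ℝ) ^ 2 / (N k : ℝ)) atTop (𝓝 c)) :
    Tendsto (fun k => (e k : ℝ) / ((N k : ℝ) - e k)) atTop (𝓝 0) := by
  have h := (asym_eN e N c he hcrit).mul (asym_ratio e N c he hN hcrit)
  rw [zero_mul] at h
  refine h.congr ?_
  intro k
  have hk' : (0:ℝ) < N k := by exact_mod_cast hN k
  field_simp

lemma asym_err (A K : ℝ) (he : Tendsto e atTop atTop) (hN : ∀ k, 0 < N k) (hc : 0 < c)
    (hcrit : Tendsto (fun k => (e k : ℝ) ^ 2 / (N k : ℝ)) atTop (𝓝 c)) :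
    Tendsto (fun k => (e k : ℝ) * ((e k * A + K + √(K * ((N k : ℝ) / e k + e k))) / ((N k : ℝ) - e k)))
      atTop (𝓝 (c * A)) := by
  have heR : Tendsto (fun k => (e k : ℝ)) atTop atTop := tendsto_natCast_atTop_atTop.comp he
  have hinv : Tendsto (fun k => ((e k : ℝ))⁻¹) atTop (𝓝 0) := tendsto_inv_atTop_zero.comp heR
  have h1 := (asym_sq e N c he hN hcrit).mul_const A
  have h2 := (asym_lin e N c he hN hcrit).mul_const K
  have h3 : Tendsto (fun k => √(K * (((e k : ℝ) ^ 2 / (N k : ℝ))⁻¹ * (e k : ℝ)⁻¹ + (e k : ℝ)⁻¹))) atTop (𝓝 0) := by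
    have a := (((hcrit.inv₀ hc.ne').mul hinv).add hinv).const_mul K
    have := (Real.continuous_sqrt.tendsto _).comp a
    simpa [Function.comp_def] using this
  have h4 := (asym_sq e N c he hN hcrit).mul h3
  have h5 := (h1.add h2).add h4
  simp only [zero_mul, mul_zero, add_zero] at h5
  refine h5.congr' ?_
  filter_upwards [he.eventually_gt_atTop 0, asym_lt e N c he hN hcrit] with k hk hlt
  have hk' : (0:ℝ) < e k := by exact_mod_cast hk
  have hN' : (0:ℝ) < N k := by exact_mod_cast hN k
  have e1 : K * (((e k : ℝ) ^ 2 / (N k : ℝ))⁻¹ * (e k : ℝ)⁻¹ + (e k : ℝ)⁻¹) =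
      K * ((N k : ℝ) / e k + e k) / (e k : ℝ) ^ 2 := by
    field_simp
  rw [e1, Real.sqrt_div' _ (by positivity), Real.sqrt_sq hk'.le]
  have : (N k : ℝ) - e k ≠ 0 := by linarith
  field_simp

lemma asym_q2 (L : ℕ) (he : Tendsto e atTop atTop) (hN : ∀ k, 0 < N k)
    (hcrit : Tendsto (fun k => (e k : ℝ) ^ 2 / (N k : ℝ)) atTop (𝓝 c)) :
    Tendsto (fun k => (e k : ℝ) * (2 * (((L:ℝ) + 1) * e k / ((N k : ℝ) - e k)) ^ 2)) atTop (𝓝 0) := by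
  have heR : Tendsto (fun k => (e k : ℝ)) atTop atTop := tendsto_natCast_atTop_atTop.comp he
  have h := (((asym_sq e N c he hN hcrit).mul (asym_lin e N c he hN hcrit)).const_mul (2 * ((L:ℝ) + 1) ^ 2))
  simp only [mul_zero] at h
  refine h.congr ?_
  intro k
  ring

lemma asym_Lam (L : ℕ) (he : Tendsto e atTop atTop) (hN : ∀ k, 0 < N k)
    (hcrit : Tendsto (fun k => (e k : ℝ) ^ 2 / (N k : ℝ)) atTop (𝓝 c)) :
    Tendsto (fun k => ∑ s ∈ Finset.range (e k), (yy L (N k) s - s) / ((N k : ℝ) - s)) atTop (𝓝 (lamL c L)) := by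
  have hU : Tendsto (fun k => (∑ s ∈ Finset.range (e k), (yy L (N k) s - s)) / (N k : ℝ)) atTop (𝓝 (lamL c L)) := by
    have h1 : ∀ l ∈ Finset.range L, Tendsto (fun k => ((e k : ℝ) ^ 2 / (N k : ℝ)) ^ (l + 2) *
        ((∑ s ∈ Finset.range (e k), (s:ℝ) ^ (2 * l + 3)) / (e k : ℝ) ^ (2 * l + 3 + 1))) atTop
        (𝓝 (c ^ (l + 2) * (1 / (((2 * l + 3 : ℕ) : ℝ) + 1)))) := by
      intro l _
      exact (hcrit.pow (l + 2)).mul (sum_pow_tendsto _ (by omega) e he)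
    have h2 := tendsto_finsetSum _ h1
    have e2 : ∑ l ∈ Finset.range L, c ^ (l + 2) * (1 / (((2 * l + 3 : ℕ) : ℝ) + 1)) = lamL c L := by
      unfold lamL
      apply Finset.sum_congr rfl
      intro l _
      push_cast
      rw [mul_one_div]
      congr 1
      ring
    rw [e2] at h2
    refine h2.congr' ?_
    filter_upwards [he.eventually_gt_atTop 0] with k hk
    have hk' : (0:ℝ) < e k := by exact_mod_cast hk
    have hN' : (0:ℝ) < N k := by exact_mod_cast hN k
    simp_rw [yy_sub]
    rw [Finset.sum_comm, Finset.sum_div]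
    apply Finset.sum_congr rfl
    intro l _
    rw [← Finset.sum_div, div_pow, ← pow_mul]
    have : (e k : ℝ) ^ (2 * (l + 2)) = (e k : ℝ) ^ (2 * l + 3 + 1) := by congr 1
    rw [this]
    field_simp
    ring
  have hU2 := hU.mul (asym_ratio e N c he hN hcrit)
  rw [mul_one] at hU2
  have hnn : ∀ k s, 0 ≤ yy L (N k) s - s := by
    intro k s
    rw [yy_sub]
    exact Finset.sum_nonneg fun _ _ => by positivity
  refine tendsto_of_tendsto_of_tendsto_of_le_of_le' hU hU2 ?_ ?_
  · filter_upwards [asym_lt e N c he hN hcrit] with k hlt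
    rw [Finset.sum_div]
    apply Finset.sum_le_sum
    intro s hs
    have : (s:ℝ) < e k := by exact_mod_cast Finset.mem_range.1 hs
    have := hnn k s
    have : 0 < (N k : ℝ) - s := by linarith
    gcongr
    have : (0:ℝ) ≤ s := by positivity
    linarith
  · filter_upwards [asym_lt e N c he hN hcrit] with k hlt
    have hN' : (0:ℝ) < N k := by exact_mod_cast hN k
    have : 0 < (N k : ℝ) - e k := by linarith
    rw [div_mul_div_cancel₀ hN'.ne', Finset.sum_div]
    apply Finset.sum_le_sum
    intro s hs
    have : (s:ℝ) < e k := by exact_mod_cast Finset.mem_range.1 hs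
    have := hnn k s
    gcongr
end asym

lemma core (n m e : ℕ → ℕ)
    (hn : Tendsto n atTop atTop) (he : Tendsto e atTop atTop)
    (hle : ∀ k, e k ≤ (n k + 1) * (m k + 1))
    (b : ℝ) (hb : 0 < b)
    (hb1 : ∀ k, (e k : ℝ) ≤ b * (n k + 1)) (hb2 : ∀ k, (e k : ℝ) ≤ b * (m k + 1))
    (c : ℝ) (hc0 : 0 < c) (hc1 : c < 1)
    (hcrit : Tendsto (fun k => (e k : ℝ) ^ 2 / (((n k + 1) * (m k + 1) : ℕ) : ℝ)) atTop (𝓝 c))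
    (j : ℕ) :
    Tendsto (fun k => avg (e k) (fun E : Finset (Cell (n k) (m k)) => ind j E)) atTop
      (𝓝 (pp j (-(Real.log (1 - c) + c) / 2))) := by
  set lam := -(Real.log (1 - c) + c) / 2 with hlam
  set c1 := (1 + c) / 2 with hc1d
  have hc10 : 0 ≤ c1 := by rw [hc1d]; linarith
  have hcc1 : c < c1 := by rw [hc1d]; linarith
  have hc11 : c1 < 1 := by rw [hc1d]; linarith
  set N : ℕ → ℕ := fun k => (n k + 1) * (m k + 1) with hNd
  have hN : ∀ k, 0 < N k := fun k => by simp only [hNd]; positivity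
  have hcrit : Tendsto (fun k => (e k : ℝ) ^ 2 / (N k : ℝ)) atTop (𝓝 c) := hcrit
  have hlam0 : 0 ≤ lam := ge_of_tendsto' (lamL_tendsto hc0 hc1) (fun L => lamL_nonneg hc0 L)
  rw [Metric.tendsto_nhds]
  intro ε hε
  -- choose L
  have hA : Tendsto (fun L : ℕ => c * (c1 ^ (L + 1) / (1 - c1))) atTop (𝓝 0) := by
    have := ((((tendsto_add_atTop_iff_nat 1).2 (tendsto_pow_atTop_nhds_zero_of_lt_one hc10 hc11)).div_const (1 - c1)).const_mul c)
    simpa using this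
  have hL1 := hA.eventually (gt_mem_nhds (show 0 < ε / 4 by positivity))
  have hL2 := (Metric.tendsto_nhds.1 (lamL_tendsto hc0 hc1)) (ε / 4) (by positivity)
  obtain ⟨L, hLA, hLl⟩ := (hL1.and hL2).exists
  rw [Real.dist_eq] at hLl
  obtain ⟨K, hK0, hK⟩ := avg_bound L b c1 hb.le hc10 hc11
  have ev1 := (asym_err e N c (c1 ^ (L + 1) / (1 - c1)) K he hN hc0 hcrit).eventually (gt_mem_nhds hLA)
  have ev2 := (asym_q2 e N c L he hN hcrit).eventually (gt_mem_nhds (show 0 < ε / 4 by positivity))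
  have ev3 := (Metric.tendsto_nhds.1 (asym_Lam e N c L he hN hcrit)) (ε / 4) (by positivity)
  have ev4 : ∀ᶠ k in atTop, ((L:ℝ) + 1) * ((e k : ℝ) / ((N k : ℝ) - e k)) < 1 := by
    have := (asym_lin e N c he hN hcrit).const_mul ((L:ℝ) + 1)
    rw [mul_zero] at this
    exact this.eventually (gt_mem_nhds zero_lt_one)
  have ev5 := hcrit.eventually (gt_mem_nhds hcc1)
  filter_upwards [ev1, ev2, ev3, ev4, ev5, asym_lt e N c he hN hcrit, he.eventually_gt_atTop 0,
    hn.eventually_ge_atTop L] with k k1 k2 k3 k4 k5 k6 k7 k8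
  rw [Real.dist_eq] at k3 ⊢
  have hN' : (0:ℝ) < N k := by exact_mod_cast hN k
  have hD : 0 < (N k : ℝ) - e k := by linarith
  have hsq : (e k : ℝ) ^ 2 ≤ c1 * N k := by
    rw [div_lt_iff₀ hN'] at k5; exact k5.le
  have hnn : ∀ s, 0 ≤ yy L (N k) s - s := by
    intro s
    rw [yy_sub]
    exact Finset.sum_nonneg fun _ _ => by positivity
  have hq0 : ∀ s < e k, 0 ≤ (yy L (N k) s - s) / ((N k : ℝ) - s) := by
    intro s hs
    have : (s:ℝ) < e k := by exact_mod_cast hs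
    exact div_nonneg (hnn s) (by linarith)
  have hqle : ∀ s < e k, (yy L (N k) s - s) / ((N k : ℝ) - s) ≤ ((L:ℝ) + 1) * e k / ((N k : ℝ) - e k) := by
    intro s hs
    have hs' : (s:ℝ) < e k := by exact_mod_cast hs
    have hs0 : (0:ℝ) ≤ s := by positivity
    have h1 : (s:ℝ) ^ 2 ≤ N k := by nlinarith
    have h2 := yy_le L h1
    apply div_le_div₀ (by positivity) _ hD (by linarith)
    nlinarith [(Nat.cast_nonneg L : (0:ℝ) ≤ L)]
  have hq1 : ∀ s < e k, (yy L (N k) s - s) / ((N k : ℝ) - s) ≤ 1 := by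
    intro s hs
    refine (hqle s hs).trans ?_
    rw [mul_div_assoc]; exact k4.le
  have hmain := main_bound (n := n k) (m := m k) (e k) j L (hle k) hq0 hq1
  have hsum : ∑ s ∈ Finset.range (e k), (avg s (fun E : Finset (Cell (n k) (m k)) => |(S E : ℝ) - yy L (N k) s|)
        / ((N k : ℝ) - s) + 2 * ((yy L (N k) s - s) / ((N k : ℝ) - s)) ^ 2) ≤
      (e k : ℝ) * ((e k * (c1 ^ (L + 1) / (1 - c1)) + K + √(K * ((N k : ℝ) / e k + e k))) / ((N k : ℝ) - e k))
      + (e k : ℝ) * (2 * (((L:ℝ) + 1) * e k / ((N k : ℝ) - e k)) ^ 2) := by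
    rw [← mul_add]
    have : ∀ x : ℝ, (e k : ℝ) * x = ∑ s ∈ Finset.range (e k), x := by intro x; simp
    rw [this]
    apply Finset.sum_le_sum
    intro s hs
    have hs := Finset.mem_range.1 hs
    have hs' : (s:ℝ) < e k := by exact_mod_cast hs
    have b1 := hK (n k) (m k) (e k) s k7 (hle k) k8 hs.le (hb1 k) (hb2 k) hsq
    have b2 := hqle s hs
    have b3 := hq0 s hs
    have hX : 0 ≤ e k * (c1 ^ (L + 1) / (1 - c1)) + K + √(K * ((N k : ℝ) / e k + e k)) := by
      have : 0 < 1 - c1 := by linarith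
      positivity
    apply add_le_add
    · exact div_le_div₀ hX b1 hD (by linarith)
    · gcongr
  have hmain := hmain.trans hsum
  have hLam0 : 0 ≤ ∑ s ∈ Finset.range (e k), (yy L (N k) s - s) / ((N k : ℝ) - s) :=
    Finset.sum_nonneg fun s hs => hq0 s (Finset.mem_range.1 hs)
  have l1 := pp_lip j (lamL_nonneg hc0 L) hLam0
  have l2 := pp_lip j hlam0 (lamL_nonneg hc0 L)
  have t1 := abs_sub_le (avg (e k) (fun E : Finset (Cell (n k) (m k)) => ind j E))
    (pp j (∑ s ∈ Finset.range (e k), (yy L (N k) s - s) / ((N k : ℝ) - s))) (pp j lam)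
  have t2 := abs_sub_le (pp j (∑ s ∈ Finset.range (e k), (yy L (N k) s - s) / ((N k : ℝ) - s)))
    (pp j (lamL c L)) (pp j lam)
  linarith

end Kal

/-- Kalugin, critical regime: if `e_k = Θ(n_k) = Θ(m_k)` and
`e_k² / ((n_k+1)(m_k+1)) → c ∈ (0,1)`, then with `λ := −(ln(1−c)+c)/2`, for every fixed
`j ≥ 0` the proportion of `e_k`-cell configurations with `N_cc = n_k + m_k + 2 − e_k + j`
tends to `λ^j · exp(−λ) / j!`. -/
theorem kalugin_critical (n m e : ℕ → ℕ)
    (hn : Tendsto n atTop atTop) (hm : Tendsto m atTop atTop) (he : Tendsto e atTop atTop)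
    (hpos : ∀ k, 0 < n k ∧ 0 < m k ∧ 0 < e k)
    (hle : ∀ k, e k ≤ (n k + 1) * (m k + 1))
    (a b : ℝ) (ha : 0 < a) (hab : a ≤ b)
    (hTheta : ∀ k, a * n k ≤ (e k : ℝ) ∧ (e k : ℝ) ≤ b * n k ∧
      a * m k ≤ (e k : ℝ) ∧ (e k : ℝ) ≤ b * m k)
    (c : ℝ) (hc : c ∈ Set.Ioo (0 : ℝ) 1)
    (hcrit : Tendsto (fun k => ((e k : ℝ) ^ 2 / ((n k + 1) * (m k + 1)))) atTop (nhds c))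
    (j : ℕ) :
    Tendsto
      (fun k =>
        (({E : Finset (Fin (n k + 1) × Fin (m k + 1)) |
            E.card = e k ∧ (Ncc (n k) (m k) E : ℤ) = n k + m k + 2 - e k + j}.ncard : ℝ)) /
          (Nat.choose ((n k + 1) * (m k + 1)) (e k) : ℝ))
      atTop
      (nhds ((-(Real.log (1 - c) + c) / 2) ^ j * Real.exp (-(-(Real.log (1 - c) + c) / 2)) /
        (Nat.factorial j : ℝ))) := by
  simp_rw [Kal.ncard_eq]
  have hb : 0 < b := lt_of_lt_of_le ha hab
  refine Kal.core n m e hn he hle b hb ?_ ?_ c hc.1 hc.2 ?_ j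
  · intro k
    have := (hTheta k).2.1
    nlinarith
  · intro k
    have := (hTheta k).2.2.2
    nlinarith
  · refine hcrit.congr ?_
    intro k
    push_cast
    rfl
end
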